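/- Let X be a random vector in ℝ^d, b ∈ ℝ^d, and let ν be a Lévy measure with polar decomposition ν(du) = 1_{(0,∞)}(r) 1_{S^{d−1}}(x) (k_x(r)/r) dr σ(dx), where σ is a finite positive measure on S^{d−1} and k_x(r) ≥ 0 is continuous and nonincreasing in r ∈ (0,∞), continuous in x ∈ S^{d−1}, with lim_{ε→0⁺} ε k_x(ε) = k_x(1) and lim_{R→∞} k_x(R) = 0 for every x, and ∫_0^∞ min(1,r²) max_{x∈S^{d−1}} k_x(r) dr/r < ∞. Assume that for every sequence (x_n) in S^{d−1} converging to x, lim_n lim_{R→∞} V_a^R(k_{x_n} − k_x) = 0 for all a > 0, where V_a^R denotes total variation on [a,R]. Let ν̃(du) = 1_{(0,∞)}(r) 1_{S^{d−1}}(x) (−dk_x(r)) σ(dx) and assume ∫ min(1,‖u‖²) ν̃(du) < ∞. Then the identity E[⟨X, ∇f(X)⟩] = ⟨b, E[∇f(X)]⟩ − E[∫_{S^{d−1}} ⟨∇f(X), x⟩ k_x(1) σ(dx)] + E[∫_{ℝ^d} (f(X+u) − f(X) − ⟨∇f(X), u⟩ 1_{‖u‖≤1}) ν̃(du)] holds for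 every f ∈ S(ℝ^d) if and only if the characteristic function of X equals φ(ξ) = exp( i⟨b,ξ⟩ + ∫_{ℝ^d} (e^{i⟨ξ,u⟩} − 1 − i⟨ξ,u⟩ 1_{‖u‖≤1}) ν(du) ), i.e., X is self-decomposable with parameter b, no Gaussian component and Lévy measure ν. -/

import Mathlib

open MeasureTheory ProbabilityTheory Filter Set
open scoped RealInnerProductSpace ENNReal NNReal Topology

noncomputable section

/-- A Lévy measure on `ℝ^d`. -/
def IsLevyMeasure {d : ℕ} (ν : Measure (EuclideanSpace ℝ (Fin d))) : Prop :=
  ν {0} = 0 ∧ ∫⁻ u, ENNReal.ofReal (min 1 (‖u‖ ^ 2)) ∂ν < ⊤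

/-- The characteristic function of a measure on `ℝ^d`. -/
def charFn {d : ℕ} (μ : Measure (EuclideanSpace ℝ (Fin d)))
    (ξ : EuclideanSpace ℝ (Fin d)) : ℂ :=
  ∫ x, Complex.exp (Complex.I * (⟪ξ, x⟫ : ℂ)) ∂μ

theorem sigmaFinite_of_lintegral_min_lt_top {E : Type*} [NormedAddCommGroup E] [MeasurableSpace E]
    [BorelSpace E] {m : Measure E} (h0 : m {0} = 0)
    (hm : ∫⁻ u, ENNReal.ofReal (min 1 (‖u‖ ^ 2)) ∂m < ⊤) : SigmaFinite m := by
  have hmeas : Measurable fun u : E => ENNReal.ofReal (min 1 (‖u‖ ^ 2)) := by fun_prop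
  have : IsFiniteMeasure (m.withDensity fun u => ENNReal.ofReal (min 1 (‖u‖ ^ 2))) :=
    isFiniteMeasure_withDensity hm.ne
  have hne : ∀ᵐ u ∂m, ENNReal.ofReal (min 1 (‖u‖ ^ 2)) ≠ 0 := by
    have : ∀ᵐ u ∂m, u ≠ 0 := by
      rw [ae_iff]; simpa using h0
    filter_upwards [this] with u hu
    have : 0 < ‖u‖ := norm_pos_iff.2 hu
    simp only [ne_eq, ENNReal.ofReal_eq_zero, not_le]
    positivity
  rw [← withDensity_inv_same hmeas hne (ae_of_all _ fun _ => ENNReal.ofReal_ne_top)]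
  have hne' : ∀ᵐ u ∂(m.withDensity fun u => ENNReal.ofReal (min 1 (‖u‖ ^ 2))),
      (fun u => (ENNReal.ofReal (min 1 (‖u‖ ^ 2)))⁻¹) u ≠ ⊤ := by
    refine (withDensity_absolutelyContinuous m _).ae_le ?_
    filter_upwards [hne] with u hu
    simpa using hu
  exact SigmaFinite.withDensity_of_ne_top hne'

/-- The Lebesgue–Stieltjes measure of a nonincreasing function on `(0, ∞)`: tails. -/
theorem stieltjes_Ioi {k : ℝ → ℝ} {τ : Measure ℝ} (hlim : Tendsto k atTop (𝓝 0))
    (hτ : ∀ a c : ℝ, 0 < a → a ≤ c → τ (Ioc a c) = ENNReal.ofReal (k a - k c))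
    {r : ℝ} (hr : 0 < r) : τ (Ioi r) = ENNReal.ofReal (k r) := by
  have hU : Ioi r = ⋃ n : ℕ, Ioc r (r + n) := by
    ext s
    simp only [mem_Ioi, mem_iUnion, mem_Ioc]
    refine ⟨fun h => ?_, fun ⟨n, h⟩ => h.1⟩
    obtain ⟨n, hn⟩ := exists_nat_ge (s - r)
    exact ⟨n, h, by linarith⟩
  have hmono : Monotone fun n : ℕ => Ioc r (r + n) := fun n m h =>
    Ioc_subset_Ioc_right (by gcongr)
  have h1 := tendsto_measure_iUnion_atTop (μ := τ) hmono
  rw [← hU] at h1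
  refine tendsto_nhds_unique h1 ?_
  have h2 : Tendsto (fun n : ℕ => ENNReal.ofReal (k r - k (r + n))) atTop
      (𝓝 (ENNReal.ofReal (k r - 0))) := by
    refine ENNReal.tendsto_ofReal (tendsto_const_nhds.sub (hlim.comp ?_))
    exact tendsto_atTop_add_const_left _ _ tendsto_natCast_atTop_atTop
  rw [sub_zero] at h2
  refine h2.congr fun n => ?_
  simp [hτ r (r + n) hr (by simp)]

theorem stieltjes_sigmaFinite {k : ℝ → ℝ} {τ : Measure ℝ} (hlim : Tendsto k atTop (𝓝 0))
    (hτ : ∀ a c : ℝ, 0 < a → a ≤ c → τ (Ioc a c) = ENNReal.ofReal (k a - k c))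
    (hτ0 : τ (Iic 0) = 0) : SigmaFinite τ := by
  refine ⟨⟨⟨fun n : ℕ => Iic 0 ∪ Ioi (1 / ((n : ℝ) + 1)), fun _ => trivial, fun n => ?_, ?_⟩⟩⟩
  · refine (measure_union_le _ _).trans_lt ?_
    rw [hτ0, stieltjes_Ioi hlim hτ (by positivity)]
    simp
  · refine eq_univ_of_forall fun s => ?_
    simp only [mem_iUnion, mem_union, mem_Iic, mem_Ioi]
    rcases le_or_gt s 0 with h | h
    · exact ⟨0, Or.inl h⟩
    · obtain ⟨n, hn⟩ := exists_nat_one_div_lt h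
      exact ⟨n, Or.inr hn⟩

theorem lintegral_Ioo_scale {s : ℝ} (hs : 0 < s) {g : ℝ → ℝ≥0∞} (hg : Measurable g) :
    ∫⁻ r in Ioo 0 s, g r * ENNReal.ofReal (1 / r)
      = ∫⁻ t in Ioo (0 : ℝ) 1, g (t * s) * ENNReal.ofReal (1 / t) := by
  have hF : Measurable ((Ioo 0 s).indicator fun r => g r * ENNReal.ofReal (1 / r)) :=
    Measurable.indicator (by fun_prop) measurableSet_Ioo
  rw [← lintegral_indicator measurableSet_Ioo, ← lintegral_indicator measurableSet_Ioo,
    ← Real.smul_map_volume_mul_right hs.ne', lintegral_smul_measure,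
    lintegral_map hF (by fun_prop), smul_eq_mul, Real.smul_map_volume_mul_right hs.ne',
    ← lintegral_const_mul (ENNReal.ofReal |s|)
      (f := fun t => (Ioo 0 s).indicator (fun r => g r * ENNReal.ofReal (1 / r)) (t * s))
      (hF.comp (measurable_mul_const s))]
  refine lintegral_congr fun t => ?_
  by_cases ht : t ∈ Ioo (0 : ℝ) 1
  · have h1 : t * s ∈ Ioo 0 s := ⟨mul_pos ht.1 hs, by nlinarith [ht.2]⟩
    rw [indicator_of_mem ht, indicator_of_mem h1, mul_left_comm,
      ← ENNReal.ofReal_mul (abs_nonneg _), abs_of_pos hs]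
    congr 2
    field_simp
  · have h1 : t * s ∉ Ioo 0 s := fun h => ht
      ⟨pos_of_mul_pos_left h.1 hs.le, by by_contra! h'; nlinarith [h.2]⟩
    rw [indicator_of_notMem ht, indicator_of_notMem h1, mul_zero]

/-- Layer-cake formula for the radial part of a self-decomposable Lévy measure. -/
theorem lintegral_radial {k : ℝ → ℝ} {τ : Measure ℝ} (hlim : Tendsto k atTop (𝓝 0))
    (hτ : ∀ a c : ℝ, 0 < a → a ≤ c → τ (Ioc a c) = ENNReal.ofReal (k a - k c))
    (hτ0 : τ (Iic 0) = 0) {g : ℝ → ℝ≥0∞} (hg : Measurable g) :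
    ∫⁻ r in Ioi (0 : ℝ), g r * ENNReal.ofReal (k r / r)
      = ∫⁻ s, (∫⁻ t in Ioo (0 : ℝ) 1, g (t * s) * ENNReal.ofReal (1 / t)) ∂τ := by
  have := stieltjes_sigmaFinite hlim hτ hτ0
  have h1 : ∀ r ∈ Ioi (0 : ℝ), g r * ENNReal.ofReal (k r / r)
      = ∫⁻ s, (if r < s then g r * ENNReal.ofReal (1 / r) else 0) ∂τ := by
    intro r hr
    have : (fun s => if r < s then g r * ENNReal.ofReal (1 / r) else 0)
        = (Ioi r).indicator fun _ => g r * ENNReal.ofReal (1 / r) := by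
      ext s; simp [indicator_apply]
    rw [this, lintegral_indicator_const measurableSet_Ioi, stieltjes_Ioi hlim hτ hr, mul_assoc,
      ← ENNReal.ofReal_mul (by simpa using le_of_lt hr)]
    congr 2
    ring
  rw [setLIntegral_congr_fun measurableSet_Ioi h1, lintegral_lintegral_swap]
  · have hpos : ∀ᵐ s ∂τ, 0 < s := by
      rw [ae_iff]; simp only [not_lt]; exact hτ0
    apply lintegral_congr_ae
    filter_upwards [hpos] with s hs
    rw [← lintegral_Ioo_scale hs hg, ← lintegral_indicator measurableSet_Ioo,
      ← lintegral_indicator measurableSet_Ioi]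
    refine lintegral_congr fun r => ?_
    simp only [indicator_apply, mem_Ioi, mem_Ioo]
    split_ifs <;> first | rfl | tauto
  · refine Measurable.aemeasurable ?_
    refine Measurable.ite (measurableSet_lt measurable_fst measurable_snd) ?_ measurable_const
    fun_prop

/-- The measure `dt / t` on `(0, 1)`. -/
def logMeasure : Measure ℝ :=
  (volume.restrict (Ioo (0 : ℝ) 1)).withDensity fun t => ENNReal.ofReal (1 / t)

instance : SigmaFinite logMeasure :=
  SigmaFinite.withDensity_ofReal _

section Polar

variable {E : Type*} [NormedAddCommGroup E] [InnerProductSpace ℝ E] [FiniteDimensional ℝ E]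
  [MeasurableSpace E] [BorelSpace E]

omit [InnerProductSpace ℝ E] [FiniteDimensional ℝ E] [BorelSpace E] in
theorem ae_norm_eq_one {σ : Measure E} (hσ : σ {x | ¬ ‖x‖ = 1} = 0) : ∀ᵐ x ∂σ, ‖x‖ = 1 := by
  rwa [ae_iff]

theorem levy_eq_map {ν νt σ : Measure E} {τ : E → Measure ℝ} {k : E → ℝ → ℝ} [SFinite νt]
    (hσ : σ {x | ¬ ‖x‖ = 1} = 0)
    (hlim : ∀ x, ‖x‖ = 1 → Tendsto (k x) atTop (𝓝 0))
    (hpolar : ∀ g : E → ℝ≥0∞, Measurable g →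
      ∫⁻ u, g u ∂ν
        = ∫⁻ x, (∫⁻ r in Ioi (0 : ℝ), g (r • x) * ENNReal.ofReal (k x r / r)) ∂σ)
    (hτ : ∀ x : E,
      (∀ a c : ℝ, 0 < a → a ≤ c → τ x (Ioc a c) = ENNReal.ofReal (k x a - k x c))
        ∧ τ x (Iic 0) = 0)
    (hνt : ∀ g : E → ℝ≥0∞, Measurable g →
      ∫⁻ u, g u ∂νt = ∫⁻ x, (∫⁻ r, g (r • x) ∂(τ x)) ∂σ) :
    ν = (νt.prod logMeasure).map fun p => p.2 • p.1 := by
  ext s hs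
  have hg : Measurable (s.indicator (1 : E → ℝ≥0∞)) := measurable_one.indicator hs
  have hmap : Measurable fun p : E × ℝ => p.2 • p.1 := by fun_prop
  have hcomp : Measurable fun p : E × ℝ => s.indicator (1 : E → ℝ≥0∞) (p.2 • p.1) :=
    hg.comp hmap
  have hG : Measurable fun u : E => ∫⁻ t in Ioo (0 : ℝ) 1,
      s.indicator (1 : E → ℝ≥0∞) (t • u) * ENNReal.ofReal (1 / t) := by
    refine Measurable.lintegral_prod_right' (f := fun p : E × ℝ =>
      s.indicator (1 : E → ℝ≥0∞) (p.2 • p.1) * ENNReal.ofReal (1 / p.2)) ?_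
    exact hcomp.mul (by fun_prop)
  calc ν s = ∫⁻ u, s.indicator (1 : E → ℝ≥0∞) u ∂ν := (lintegral_indicator_one hs).symm
    _ = ∫⁻ x, (∫⁻ r, (∫⁻ t in Ioo (0 : ℝ) 1,
          s.indicator (1 : E → ℝ≥0∞) (t • (r • x)) * ENNReal.ofReal (1 / t)) ∂(τ x)) ∂σ := by
        rw [hpolar _ hg]
        apply lintegral_congr_ae
        filter_upwards [ae_norm_eq_one hσ] with x hx
        rw [lintegral_radial (g := fun r => s.indicator (1 : E → ℝ≥0∞) (r • x))
          (hlim x hx) (hτ x).1 (hτ x).2 (hg.comp (by fun_prop))]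
        simp only [mul_smul]
    _ = ∫⁻ u, (∫⁻ t in Ioo (0 : ℝ) 1,
          s.indicator (1 : E → ℝ≥0∞) (t • u) * ENNReal.ofReal (1 / t)) ∂νt := (hνt _ hG).symm
    _ = _ := by
        rw [← lintegral_indicator_one hs, lintegral_map hg hmap,
          lintegral_prod _ hcomp.aemeasurable]
        refine lintegral_congr fun u => ?_
        have hu : Measurable fun t : ℝ => s.indicator (1 : E → ℝ≥0∞) (t • u) :=
          hcomp.comp measurable_prodMk_left
        have := lintegral_withDensity_eq_lintegral_mul (volume.restrict (Ioo (0 : ℝ) 1))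
          (f := fun t => ENNReal.ofReal (1 / t)) (by fun_prop) hu
        rw [logMeasure, this]
        simp only [Pi.mul_apply, mul_comm]

theorem drift_eq_map {νt σ : Measure E} {τ : E → Measure ℝ} {k : E → ℝ → ℝ}
    (hσ : σ {x | ¬ ‖x‖ = 1} = 0) [SFinite σ]
    (hlim : ∀ x, ‖x‖ = 1 → Tendsto (k x) atTop (𝓝 0))
    (hτ : ∀ x : E,
      (∀ a c : ℝ, 0 < a → a ≤ c → τ x (Ioc a c) = ENNReal.ofReal (k x a - k x c))
        ∧ τ x (Iic 0) = 0)
    (hνt : ∀ g : E → ℝ≥0∞, Measurable g →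
      ∫⁻ u, g u ∂νt = ∫⁻ x, (∫⁻ r, g (r • x) ∂(τ x)) ∂σ) :
    σ.withDensity (fun x => ENNReal.ofReal (k x 1))
      = (νt.restrict {u | 1 < ‖u‖}).map fun u => ‖u‖⁻¹ • u := by
  have hS : MeasurableSet {u : E | 1 < ‖u‖} := measurableSet_lt measurable_const measurable_norm
  have hmap : Measurable fun u : E => ‖u‖⁻¹ • u := by fun_prop
  ext s hs
  have hT : MeasurableSet ((fun u : E => ‖u‖⁻¹ • u) ⁻¹' s ∩ {u | 1 < ‖u‖}) := (hmap hs).inter hS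
  rw [withDensity_apply _ hs, Measure.map_apply hmap hs, Measure.restrict_apply (hmap hs),
    ← lintegral_indicator_one hT, hνt _ (measurable_one.indicator hT), ← lintegral_indicator hs]
  apply lintegral_congr_ae
  filter_upwards [ae_norm_eq_one hσ] with x hx
  have h1 : (fun r : ℝ => ((fun u : E => ‖u‖⁻¹ • u) ⁻¹' s ∩ {u | 1 < ‖u‖}).indicator
      (1 : E → ℝ≥0∞) (r • x)) =ᵐ[τ x] (Ioi 1).indicator fun _ => s.indicator 1 x := by
    have hpos : ∀ᵐ r ∂(τ x), 0 < r := by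
      rw [ae_iff]; simp only [not_lt]; exact (hτ x).2
    filter_upwards [hpos] with r hr
    classical
    have hn : ‖r • x‖ = r := by rw [norm_smul, hx, mul_one, Real.norm_of_nonneg hr.le]
    have hn' : r⁻¹ • (r • x) = x := by rw [smul_smul, inv_mul_cancel₀ hr.ne', one_smul]
    simp only [indicator_apply, mem_inter_iff, mem_preimage, hn, hn', mem_ofPred_eq, mem_Ioi]
    split_ifs <;> first | rfl | tauto
  rw [lintegral_congr_ae h1, lintegral_indicator_const measurableSet_Ioi,
    stieltjes_Ioi (hlim x hx) (hτ x).1 one_pos]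
  by_cases hxs : x ∈ s <;> simp [hxs]

omit [InnerProductSpace ℝ E] [FiniteDimensional ℝ E] [BorelSpace E] in
theorem restrict_sphere_eq {σ : Measure E} (hσ : σ {x | ¬ ‖x‖ = 1} = 0) :
    σ.restrict {x | ‖x‖ = 1} = σ :=
  Measure.restrict_eq_self_of_ae_mem (ae_norm_eq_one hσ)

theorem integrable_drift {σ : Measure E} [IsFiniteMeasure σ] {k : E → ℝ}
    (hσ : σ {x | ¬ ‖x‖ = 1} = 0) (hk : ContinuousOn k {x | ‖x‖ = 1}) :
    Integrable (fun y => k y • y) σ := by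
  have hS : {x : E | ‖x‖ = 1} = Metric.sphere 0 1 := by ext; simp
  have : IntegrableOn (fun y => k y • y) {x | ‖x‖ = 1} σ := by
    refine ContinuousOn.integrableOn_compact ?_ (hk.smul continuousOn_id)
    rw [hS]; exact isCompact_sphere 0 1
  rwa [IntegrableOn, restrict_sphere_eq hσ] at this

theorem drift_eq_integral {νt σ : Measure E} {τ : E → Measure ℝ} {k : E → ℝ → ℝ}
    (hσ : σ {x | ¬ ‖x‖ = 1} = 0) [IsFiniteMeasure σ]
    (hk0 : ∀ x, 0 ≤ k x 1)
    (hkc : ContinuousOn (fun x => k x 1) {x | ‖x‖ = 1})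
    (hlim : ∀ x, ‖x‖ = 1 → Tendsto (k x) atTop (𝓝 0))
    (hτ : ∀ x : E,
      (∀ a c : ℝ, 0 < a → a ≤ c → τ x (Ioc a c) = ENNReal.ofReal (k x a - k x c))
        ∧ τ x (Iic 0) = 0)
    (hνt : ∀ g : E → ℝ≥0∞, Measurable g →
      ∫⁻ u, g u ∂νt = ∫⁻ x, (∫⁻ r, g (r • x) ∂(τ x)) ∂σ) :
    ∫ y, k y 1 • y ∂σ = ∫ u in {u | 1 < ‖u‖}, ‖u‖⁻¹ • u ∂νt := by
  have hS : MeasurableSet {x : E | ‖x‖ = 1} := measurableSet_eq_fun measurable_norm measurable_const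
  have hm : AEMeasurable (fun x => k x 1) σ := by
    rw [← restrict_sphere_eq hσ]
    exact hkc.aemeasurable hS
  have h1 := integral_withDensity_eq_integral_toReal_smul₀ hm.ennreal_ofReal
    (ae_of_all _ fun _ => ENNReal.ofReal_lt_top) (fun y : E => y)
  rw [drift_eq_map hσ hlim hτ hνt, integral_map (by fun_prop) (by fun_prop)] at h1
  rw [h1]
  simp only [ENNReal.toReal_ofReal (hk0 _)]

end Polar

/-- The Lévy–Khintchine kernel `e^{i⟨ξ,u⟩} - 1 - i⟨ξ,u⟩ 1_{‖u‖≤1}`. -/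
def levyKernel {E : Type*} [NormedAddCommGroup E] [InnerProductSpace ℝ E]
    (ξ u : E) : ℂ :=
  Complex.exp (Complex.I * ((⟪ξ, u⟫ : ℝ) : ℂ)) - 1
    - (if ‖u‖ ≤ 1 then Complex.I * ((⟪ξ, u⟫ : ℝ) : ℂ) else 0)

/-- The Lévy–Khintchine exponent with drift `b`, no Gaussian part and Lévy measure `m`. -/
def levyExponent {E : Type*} [NormedAddCommGroup E] [InnerProductSpace ℝ E]
    [MeasurableSpace E] (b : E) (m : Measure E) (ξ : E) : ℂ :=
  Complex.I * ((⟪b, ξ⟫ : ℝ) : ℂ) + ∫ u, levyKernel ξ u ∂m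

theorem norm_exp_I_mul_sub_one_sub_le (a : ℝ) :
    ‖Complex.exp (Complex.I * a) - 1 - Complex.I * a‖ ≤ 2 * a ^ 2 := by
  rcases le_total |a| 1 with h | h
  · have h1 : ‖Complex.I * (a : ℂ)‖ ≤ 1 := by simpa using h
    refine (Complex.norm_exp_sub_one_sub_id_le h1).trans ?_
    simp only [norm_mul, Complex.norm_I, Complex.norm_real, Real.norm_eq_abs, one_mul, sq_abs]
    nlinarith [sq_nonneg a]
  · calc _ ≤ ‖Complex.exp (Complex.I * a) - 1‖ + ‖Complex.I * (a : ℂ)‖ := norm_sub_le _ _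
      _ ≤ |a| + |a| := by
        gcongr
        · exact Real.norm_exp_I_mul_ofReal_sub_one_le
        · simp
      _ ≤ 2 * a ^ 2 := by rw [← sq_abs]; nlinarith

section

variable {E : Type*} [NormedAddCommGroup E] [InnerProductSpace ℝ E]

theorem norm_levyKernel_le (ξ u : E) :
    ‖levyKernel ξ u‖ ≤ 2 * (1 + ‖ξ‖ ^ 2) * min 1 (‖u‖ ^ 2) := by
  unfold levyKernel
  split_ifs with h
  · have h1 : ‖u‖ ^ 2 ≤ 1 := pow_le_one₀ (norm_nonneg _) h
    rw [min_eq_right h1]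
    refine (norm_exp_I_mul_sub_one_sub_le _).trans ?_
    have h2 : ⟪ξ, u⟫ ^ 2 ≤ (‖ξ‖ * ‖u‖) ^ 2 := by
      rw [← sq_abs]
      gcongr
      exact abs_real_inner_le_norm _ _
    nlinarith [sq_nonneg ‖u‖, sq_nonneg ‖ξ‖]
  · have h1 : 1 ≤ ‖u‖ ^ 2 := one_le_pow₀ (le_of_not_ge h)
    rw [min_eq_left h1, sub_zero]
    calc _ ≤ ‖Complex.exp (Complex.I * ((⟪ξ, u⟫ : ℝ) : ℂ))‖ + ‖(1 : ℂ)‖ := norm_sub_le _ _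
      _ ≤ _ := by
        rw [Complex.norm_exp_I_mul_ofReal, norm_one]
        nlinarith [sq_nonneg ‖ξ‖]

theorem continuous_levyKernel (u : E) : Continuous fun ξ : E => levyKernel ξ u := by
  unfold levyKernel
  split_ifs <;> fun_prop

variable [MeasurableSpace E] [BorelSpace E]

theorem measurable_levyKernel [SecondCountableTopology E] :
    Measurable fun p : E × E => levyKernel p.1 p.2 := by
  unfold levyKernel
  refine Measurable.sub (by fun_prop) (Measurable.ite ?_ (by fun_prop) measurable_const)
  exact measurableSet_le (by fun_prop) measurable_const

omit [InnerProductSpace ℝ E] in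
theorem integrable_min_one_sq {m : Measure E}
    (hm : ∫⁻ u, ENNReal.ofReal (min 1 (‖u‖ ^ 2)) ∂m < ⊤) :
    Integrable (fun u => min 1 (‖u‖ ^ 2)) m :=
  (lintegral_ofReal_ne_top_iff_integrable (by fun_prop) (ae_of_all _ fun _ => by positivity)).1
    hm.ne

variable [FiniteDimensional ℝ E]

theorem integrable_levyKernel_smul {m : Measure E} (hm : Integrable (fun u => min 1 (‖u‖ ^ 2)) m)
    (ξ : E) {t : ℝ} (ht0 : 0 ≤ t) (ht : t ≤ 1) : Integrable (fun u => levyKernel ξ (t • u)) m := by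
  refine (hm.const_mul (2 * (1 + ‖ξ‖ ^ 2))).mono' ?_ (ae_of_all _ fun u => ?_)
  · exact (measurable_levyKernel.comp
      (measurable_const.prodMk (measurable_const_smul t))).aestronglyMeasurable
  · refine (norm_levyKernel_le _ _).trans ?_
    gcongr
    rw [norm_smul, Real.norm_of_nonneg ht0]
    exact mul_le_of_le_one_left (norm_nonneg _) ht

theorem integrable_levyKernel {m : Measure E} (hm : Integrable (fun u => min 1 (‖u‖ ^ 2)) m)
    (ξ : E) : Integrable (levyKernel ξ) m := by
  simpa using integrable_levyKernel_smul hm ξ zero_le_one le_rfl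

theorem continuous_levyExponent (b : E) {m : Measure E}
    (hm : Integrable (fun u => min 1 (‖u‖ ^ 2)) m) : Continuous (levyExponent b m) := by
  unfold levyExponent
  refine Continuous.add (by fun_prop) ?_
  rw [continuous_iff_continuousAt]
  intro ξ₀
  refine continuousAt_of_dominated (bound := fun u => 2 * (1 + (‖ξ₀‖ + 1) ^ 2) * min 1 (‖u‖ ^ 2))
    ?_ ?_ (hm.const_mul _) (ae_of_all _ fun u => (continuous_levyKernel u).continuousAt)
  · exact Eventually.of_forall fun ξ => (integrable_levyKernel hm ξ).aestronglyMeasurable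
  · filter_upwards [Metric.ball_mem_nhds ξ₀ one_pos] with ξ hξ
    refine ae_of_all _ fun u => (norm_levyKernel_le _ _).trans ?_
    gcongr
    have : ‖ξ - ξ₀‖ < 1 := by simpa [dist_eq_norm] using hξ
    linarith [norm_le_norm_add_norm_sub' ξ ξ₀, norm_sub_rev ξ ξ₀]

omit [BorelSpace E] [FiniteDimensional ℝ E] in
theorem norm_levyExponent_le (b : E) {m : Measure E}
    (hm : Integrable (fun u => min 1 (‖u‖ ^ 2)) m) (ξ : E) :
    ‖levyExponent b m ξ‖ ≤ (‖b‖ + 2 * ∫ u, min 1 (‖u‖ ^ 2) ∂m) * (1 + ‖ξ‖ ^ 2) := by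
  have h1 : ‖∫ u, levyKernel ξ u ∂m‖ ≤ 2 * (1 + ‖ξ‖ ^ 2) * ∫ u, min 1 (‖u‖ ^ 2) ∂m := by
    rw [← integral_const_mul]
    exact norm_integral_le_of_norm_le (hm.const_mul _) (ae_of_all _ (norm_levyKernel_le ξ))
  have h2 : ‖Complex.I * ((⟪b, ξ⟫ : ℝ) : ℂ)‖ ≤ ‖b‖ * (1 + ‖ξ‖ ^ 2) := by
    rw [norm_mul, Complex.norm_I, one_mul, Complex.norm_real]
    refine (abs_real_inner_le_norm _ _).trans ?_
    gcongr
    nlinarith [sq_nonneg (‖ξ‖ - 1)]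
  calc _ ≤ _ := norm_add_le _ _
    _ ≤ _ := add_le_add h2 h1
    _ = _ := by ring

omit [MeasurableSpace E] [BorelSpace E] [FiniteDimensional ℝ E] in
/-- The defect of homogeneity of the compensator in the Lévy–Khintchine kernel. -/
theorem levyKernel_smul_right (ξ u : E) {t : ℝ} (ht0 : 0 < t) (ht : t < 1) :
    levyKernel ξ (t • u) = levyKernel (t • ξ) u
      - t * {p : E × ℝ | 1 < ‖p.1‖ ∧ p.2 * ‖p.1‖ ≤ 1}.indicator
          (fun p => Complex.I * ((⟪ξ, p.1⟫ : ℝ) : ℂ)) (u, t) := by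
  classical
  have hn : ‖t • u‖ = t * ‖u‖ := by rw [norm_smul, Real.norm_of_nonneg ht0.le]
  simp only [levyKernel, inner_smul_left, inner_smul_right, hn, indicator_apply, mem_ofPred_eq]
  rcases le_or_gt ‖u‖ 1 with h | h
  · have h' : t * ‖u‖ ≤ 1 := by nlinarith [norm_nonneg u]
    simp [h, h', not_lt.2 h]
  · by_cases h' : t * ‖u‖ ≤ 1
    · simp [h, h', not_le.2 h]; ring
    · simp [h', not_le.2 h]

end

section

variable {E : Type*} [NormedAddCommGroup E] [InnerProductSpace ℝ E] [FiniteDimensional ℝ E]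
  [MeasurableSpace E] [BorelSpace E]

theorem integral_logMeasure (F : ℝ → ℂ) :
    ∫ t, F t ∂logMeasure = ∫ t in Ioo (0 : ℝ) 1, ((1 / t : ℝ) : ℂ) * F t := by
  rw [logMeasure, integral_withDensity_eq_integral_toReal_smul (by fun_prop)
    (ae_of_all _ fun _ => ENNReal.ofReal_lt_top)]
  refine setIntegral_congr_fun measurableSet_Ioo fun t ht => ?_
  have : 0 ≤ 1 / t := by have := ht.1; positivity
  simp only [ENNReal.toReal_ofReal this, Complex.real_smul]

theorem integrable_logMeasure {F : ℝ → ℂ} (h : Integrable F logMeasure) :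
    IntegrableOn (fun t => ((1 / t : ℝ) : ℂ) * F t) (Ioo 0 1) := by
  rw [logMeasure, integrable_withDensity_iff_integrable_smul' (by fun_prop)
    (ae_of_all _ fun _ => ENNReal.ofReal_lt_top)] at h
  refine IntegrableOn.congr_fun h (fun t ht => ?_) measurableSet_Ioo
  have : 0 ≤ 1 / t := by have := ht.1; positivity
  simp only [ENNReal.toReal_ofReal this, Complex.real_smul]

theorem one_div_mul_inter_Ioo {a : ℝ} (ha : 1 < a) :
    {t : ℝ | t * a ≤ 1} ∩ Ioo 0 1 = Ioc 0 a⁻¹ := by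
  ext t
  have h0 : 0 < a := by linarith
  have h1 : a⁻¹ < 1 := inv_lt_one_of_one_lt₀ ha
  have h2 : t * a ≤ 1 ↔ t ≤ a⁻¹ := by
    rw [← one_div, le_div_iff₀ h0]
  simp only [mem_inter_iff, mem_ofPred_eq, mem_Ioo, mem_Ioc, h2]
  constructor
  · tauto
  · intro h; exact ⟨h.2, h.1, by linarith [h.2]⟩

/-- The region where a jump is large but its contraction by `t` is small. -/
def largeJumps (E : Type*) [NormedAddCommGroup E] : Set (E × ℝ) :=
  {p | 1 < ‖p.1‖ ∧ p.2 * ‖p.1‖ ≤ 1}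

omit [InnerProductSpace ℝ E] [FiniteDimensional ℝ E] [MeasurableSpace E] [BorelSpace E] in
theorem setIntegral_indicator_largeJumps {F : Type*} [NormedAddCommGroup F] [NormedSpace ℝ F]
    [CompleteSpace F] (f : E → F) (u : E) :
    ∫ t in Ioo (0 : ℝ) 1, (largeJumps E).indicator (fun p => f p.1) (u, t)
      = {u : E | 1 < ‖u‖}.indicator (fun u => ‖u‖⁻¹ • f u) u := by
  classical
  by_cases h : 1 < ‖u‖
  · have h1 : (fun t : ℝ => (largeJumps E).indicator (fun p => f p.1) (u, t))
        = {t : ℝ | t * ‖u‖ ≤ 1}.indicator fun _ => f u := by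
      ext t; simp [indicator_apply, h, largeJumps]
    have hm : MeasurableSet {t : ℝ | t * ‖u‖ ≤ 1} := measurableSet_le (by fun_prop) (by fun_prop)
    rw [h1, integral_indicator_const _ hm, measureReal_restrict_apply hm,
      one_div_mul_inter_Ioo h]
    simp [h]
  · have h1 : (fun t : ℝ => (largeJumps E).indicator (fun p => f p.1) (u, t)) = 0 := by
      ext t; simp [h, largeJumps]
    rw [h1]
    simp [h]

omit [InnerProductSpace ℝ E] [FiniteDimensional ℝ E] in
theorem measurableSet_largeJumps : MeasurableSet (largeJumps E) := by
  have h1 : MeasurableSet {p : E × ℝ | 1 < ‖p.1‖} :=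
    measurableSet_lt measurable_const (by fun_prop)
  have h2 : MeasurableSet {p : E × ℝ | p.2 * ‖p.1‖ ≤ 1} :=
    measurableSet_le (by fun_prop) measurable_const
  exact h1.inter h2

omit [InnerProductSpace ℝ E] [FiniteDimensional ℝ E] in
theorem measurableSet_one_lt_norm : MeasurableSet {u : E | 1 < ‖u‖} :=
  measurableSet_lt measurable_const measurable_norm

omit [InnerProductSpace ℝ E] [FiniteDimensional ℝ E] [BorelSpace E] in
theorem measure_one_lt_norm_lt_top {m : Measure E}
    (hm : Integrable (fun u => min 1 (‖u‖ ^ 2)) m) : m {u | 1 < ‖u‖} < ⊤ := by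
  refine (measure_mono ?_).trans_lt (hm.measure_ge_lt_top one_pos)
  intro u hu
  exact le_min le_rfl (one_le_pow₀ (le_of_lt (show 1 < ‖u‖ from hu)))

theorem integrableOn_inv_norm_smul {m : Measure E}
    (hm : Integrable (fun u => min 1 (‖u‖ ^ 2)) m) :
    IntegrableOn (fun u : E => ‖u‖⁻¹ • u) {u | 1 < ‖u‖} m := by
  refine Measure.integrableOn_of_bounded (M := 1) (measure_one_lt_norm_lt_top hm).ne
    (by fun_prop) (ae_of_all _ fun u => ?_)
  rw [norm_smul, norm_inv, norm_norm]
  exact inv_mul_le_one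

theorem integrable_largeJumps {m : Measure E} [SFinite m]
    (hm : Integrable (fun u => min 1 (‖u‖ ^ 2)) m) (ξ : E) :
    Integrable ((largeJumps E).indicator fun p => Complex.I * ((⟪ξ, p.1⟫ : ℝ) : ℂ))
      (m.prod (volume.restrict (Ioo (0 : ℝ) 1))) := by
  have hmeas : Measurable
      ((largeJumps E).indicator fun p => Complex.I * ((⟪ξ, p.1⟫ : ℝ) : ℂ)) :=
    Measurable.indicator (by fun_prop) measurableSet_largeJumps
  rw [integrable_prod_iff hmeas.aestronglyMeasurable]
  refine ⟨ae_of_all _ fun u => ?_, ?_⟩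
  · refine Integrable.of_bound (C := ‖Complex.I * ((⟪ξ, u⟫ : ℝ) : ℂ)‖)
      (hmeas.comp measurable_prodMk_left).aestronglyMeasurable (ae_of_all _ fun t => ?_)
    exact norm_indicator_le_norm_self (fun p : E × ℝ => Complex.I * ((⟪ξ, p.1⟫ : ℝ) : ℂ)) (u, t)
  · simp only [norm_indicator_eq_indicator_norm]
    simp only [setIntegral_indicator_largeJumps fun u : E => ‖Complex.I * ((⟪ξ, u⟫ : ℝ) : ℂ)‖]
    rw [integrable_indicator_iff measurableSet_one_lt_norm]
    refine Integrable.congr (((integrableOn_inv_norm_smul hm).inner_const (𝕜 := ℝ) ξ).norm)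
      (ae_of_all _ fun u => ?_)
    simp [inner_smul_left, real_inner_comm]

theorem integral_largeJumps {m : Measure E} [SFinite m]
    (hm : Integrable (fun u => min 1 (‖u‖ ^ 2)) m) (ξ : E) :
    ∫ t in Ioo (0 : ℝ) 1, ∫ u,
        (largeJumps E).indicator (fun p => Complex.I * ((⟪ξ, p.1⟫ : ℝ) : ℂ)) (u, t) ∂m
      = Complex.I * ((⟪∫ u in {u | 1 < ‖u‖}, ‖u‖⁻¹ • u ∂m, ξ⟫ : ℝ) : ℂ) := by
  rw [← integral_prod_symm _ (integrable_largeJumps hm ξ),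
    integral_prod _ (integrable_largeJumps hm ξ)]
  simp only [setIntegral_indicator_largeJumps fun u : E => Complex.I * ((⟪ξ, u⟫ : ℝ) : ℂ)]
  rw [integral_indicator measurableSet_one_lt_norm, real_inner_comm,
    ← integral_inner (integrableOn_inv_norm_smul hm) ξ, ← integral_complex_ofReal, ← integral_const_mul]
  refine integral_congr_ae (ae_of_all _ fun u => ?_)
  simp only [inner_smul_right, Complex.real_smul]
  push_cast
  ring

theorem measurable_levyKernel_right (ξ : E) : Measurable (levyKernel ξ) := by
  have h := measurable_levyKernel.comp (measurable_prodMk_left (x := ξ) (β := E))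
  exact h

theorem integrable_levyKernel_map {ν m : Measure E}
    (hν : Integrable (fun u => min 1 (‖u‖ ^ 2)) ν)
    (hνm : ν = (m.prod logMeasure).map fun p => p.2 • p.1) (ξ : E) :
    Integrable (fun p : E × ℝ => levyKernel ξ (p.2 • p.1)) (m.prod logMeasure) := by
  have hmap : Measurable fun p : E × ℝ => p.2 • p.1 := by fun_prop
  have hker := measurable_levyKernel_right ξ
  have hK := integrable_levyKernel hν ξ
  rw [hνm] at hK
  exact (integrable_map_measure hker.aestronglyMeasurable hmap.aemeasurable).1 hK

theorem integral_levyKernel_map {ν m : Measure E} [SFinite m]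
    (hν : Integrable (fun u => min 1 (‖u‖ ^ 2)) ν)
    (hνm : ν = (m.prod logMeasure).map fun p => p.2 • p.1) (ξ : E) :
    IntegrableOn (fun t : ℝ => ((1 / t : ℝ) : ℂ) * ∫ u, levyKernel ξ (t • u) ∂m) (Ioo 0 1) ∧
    ∫ u, levyKernel ξ u ∂ν
      = ∫ t in Ioo (0 : ℝ) 1, ((1 / t : ℝ) : ℂ) * ∫ u, levyKernel ξ (t • u) ∂m := by
  have hmap : Measurable fun p : E × ℝ => p.2 • p.1 := by fun_prop
  have hker := measurable_levyKernel_right ξ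
  have hK := integrable_levyKernel_map hν hνm ξ
  refine ⟨integrable_logMeasure (F := fun t => ∫ u, levyKernel ξ (t • u) ∂m)
    hK.integral_prod_right, ?_⟩
  have h1 : ∫ u, levyKernel ξ u ∂ν = ∫ p, levyKernel ξ (p.2 • p.1) ∂(m.prod logMeasure) := by
    rw [hνm]; exact integral_map hmap.aemeasurable hker.aestronglyMeasurable
  rw [h1, ← integral_logMeasure]
  exact integral_prod_symm (fun p : E × ℝ => levyKernel ξ (p.2 • p.1)) hK

theorem one_div_mul_levyExponent {m : Measure E}
    (hm : Integrable (fun u => min 1 (‖u‖ ^ 2)) m) (β ξ : E) {t : ℝ} (ht : t ∈ Ioo (0 : ℝ) 1) :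
    ((1 / t : ℝ) : ℂ) * levyExponent β m (t • ξ)
      = Complex.I * ((⟪β, ξ⟫ : ℝ) : ℂ)
        + ((((1 / t : ℝ) : ℂ) * ∫ u, levyKernel ξ (t • u) ∂m)
          + ∫ u, (largeJumps E).indicator (fun p => Complex.I * ((⟪ξ, p.1⟫ : ℝ) : ℂ)) (u, t) ∂m)
    := by
  have ht' : (t : ℂ) ≠ 0 := by exact_mod_cast ht.1.ne'
  have h1 : ∀ u, (largeJumps E).indicator (fun p => Complex.I * ((⟪ξ, p.1⟫ : ℝ) : ℂ)) (u, t)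
      = (t : ℂ)⁻¹ * (levyKernel (t • ξ) u - levyKernel ξ (t • u)) := by
    intro u
    rw [levyKernel_smul_right ξ u ht.1 ht.2, sub_sub_cancel, ← mul_assoc, inv_mul_cancel₀ ht',
      one_mul]
    rfl
  simp_rw [h1]
  rw [integral_const_mul, integral_sub (integrable_levyKernel hm _)
    (integrable_levyKernel_smul hm ξ ht.1.le ht.2.le), levyExponent]
  simp only [inner_smul_right, Complex.ofReal_div, Complex.ofReal_one, Complex.ofReal_mul]
  field_simp
  ring

theorem levyExponent_eq_integral {ν m : Measure E} [SFinite m]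
    (hν : Integrable (fun u => min 1 (‖u‖ ^ 2)) ν)
    (hm : Integrable (fun u => min 1 (‖u‖ ^ 2)) m)
    (hνm : ν = (m.prod logMeasure).map fun p => p.2 • p.1) {b β : E}
    (hβ : b = β + ∫ u in {u | 1 < ‖u‖}, ‖u‖⁻¹ • u ∂m) (ξ : E) :
    IntegrableOn (fun t : ℝ => ((1 / t : ℝ) : ℂ) * levyExponent β m (t • ξ)) (Ioo 0 1) ∧
    levyExponent b ν ξ = ∫ t in Ioo (0 : ℝ) 1, ((1 / t : ℝ) : ℂ) * levyExponent β m (t • ξ) := by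
  obtain ⟨hInt, hK⟩ := integral_levyKernel_map hν hνm ξ
  have hD : IntegrableOn (fun t : ℝ => ∫ u,
      (largeJumps E).indicator (fun p => Complex.I * ((⟪ξ, p.1⟫ : ℝ) : ℂ)) (u, t) ∂m) (Ioo 0 1) :=
    (integrable_largeJumps hm ξ).integral_prod_right
  have hconst : IntegrableOn (fun _ : ℝ => Complex.I * ((⟪β, ξ⟫ : ℝ) : ℂ)) (Ioo 0 1) :=
    integrableOn_const (by simp)
  refine ⟨(hconst.add (hInt.add hD)).congr_fun
    (fun t ht => (one_div_mul_levyExponent hm β ξ ht).symm) measurableSet_Ioo, ?_⟩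
  rw [setIntegral_congr_fun measurableSet_Ioo fun t ht => one_div_mul_levyExponent hm β ξ ht,
    integral_add hconst, integral_add hInt hD]
  rw [← hK, integral_largeJumps hm ξ, setIntegral_const, levyExponent, hβ, inner_add_left]
  · simp
    ring
  · exact hInt.add hD

/-- Radial differential equation satisfied by a self-decomposable Lévy exponent. -/
theorem hasDerivAt_levyExponent_smul {ν m : Measure E} [SFinite m]
    (hν : Integrable (fun u => min 1 (‖u‖ ^ 2)) ν)
    (hm : Integrable (fun u => min 1 (‖u‖ ^ 2)) m)
    (hνm : ν = (m.prod logMeasure).map fun p => p.2 • p.1) {b β : E}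
    (hβ : b = β + ∫ u in {u | 1 < ‖u‖}, ‖u‖⁻¹ • u ∂m) (ξ : E) {s : ℝ} (hs : 0 < s) :
    HasDerivAt (fun s : ℝ => levyExponent b ν (s • ξ))
      (((1 / s : ℝ) : ℂ) * levyExponent β m (s • ξ)) s := by
  set f : ℝ → ℂ := fun t => ((1 / t : ℝ) : ℂ) * levyExponent β m (t • ξ) with hf
  have hcont : ContinuousOn f (Ioi 0) := by
    refine ContinuousOn.mul ?_ ?_
    · refine Complex.continuous_ofReal.comp_continuousOn ?_
      exact continuousOn_const.div continuousOn_id fun t ht => (mem_Ioi.1 ht).ne'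
    · exact ((continuous_levyExponent β hm).comp (by fun_prop)).continuousOn
  have h01 : IntervalIntegrable f volume 0 1 := by
    rw [intervalIntegrable_iff_integrableOn_Ioo_of_le zero_le_one]
    exact (levyExponent_eq_integral hν hm hνm hβ ξ).1
  have h0s : IntervalIntegrable f volume 0 s :=
    h01.trans (hcont.mono fun t ht => lt_of_lt_of_le (lt_min one_pos hs) ht.1).intervalIntegrable
  have hψ : ∀ r : ℝ, 0 < r → levyExponent b ν (r • ξ) = ∫ t in (0 : ℝ)..r, f t := by
    intro r hr
    have h1 := intervalIntegral.integral_comp_mul_right (a := 0) (b := 1) f hr.ne'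
    rw [zero_mul, one_mul] at h1
    have h2 : ∫ t in (0 : ℝ)..r, f t = r • ∫ t in (0 : ℝ)..1, f (t * r) := by
      rw [h1, smul_smul, mul_inv_cancel₀ hr.ne', one_smul]
    rw [h2, (levyExponent_eq_integral hν hm hνm hβ (r • ξ)).2,
      intervalIntegral.integral_of_le zero_le_one, integral_Ioc_eq_integral_Ioo, ← integral_smul]
    refine setIntegral_congr_fun measurableSet_Ioo fun t ht => ?_
    simp only [hf, smul_smul, Complex.real_smul]
    have hr' : (r : ℂ) ≠ 0 := by exact_mod_cast hr.ne'
    push_cast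
    field_simp
  have h3 : HasDerivAt (fun r => ∫ t in (0 : ℝ)..r, f t) (f s) s :=
    intervalIntegral.integral_hasDerivAt_right h0s
      (hcont.stronglyMeasurableAtFilter isOpen_Ioi s hs)
      (hcont.continuousAt (Ioi_mem_nhds hs))
  refine h3.congr_of_eventuallyEq ?_
  filter_upwards [Ioi_mem_nhds hs] with r hr using hψ r hr

/-- The superposition of plane waves `e^{i⟨ξ,x⟩}` with amplitude `g ξ`. -/
def waveIntegral (g : E → ℂ) (x : E) : ℂ :=
  ∫ ξ, g ξ * Complex.exp (Complex.I * ((⟪ξ, x⟫ : ℝ) : ℂ))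

theorem norm_mul_wave (z : ℂ) (a : ℝ) : ‖z * Complex.exp (Complex.I * (a : ℂ))‖ = ‖z‖ := by
  rw [norm_mul, Complex.norm_exp_I_mul_ofReal, mul_one]

/-- Dilation by a nonzero real number as a continuous linear equivalence. -/
def dilation (E : Type*) [NormedAddCommGroup E] [InnerProductSpace ℝ E] {c : ℝ}
    (hc : c ≠ 0) : E ≃L[ℝ] E :=
  ContinuousLinearEquiv.smulLeft (Units.mk0 c hc)

omit [FiniteDimensional ℝ E] [MeasurableSpace E] [BorelSpace E] in
theorem dilation_apply {c : ℝ} (hc : c ≠ 0) (x : E) : dilation E hc x = c • x := rfl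

theorem waveIntegral_eq_fourierInv (g : E → ℂ) (x : E) :
    waveIntegral g x = FourierTransformInv.fourierInv g ((2 * Real.pi)⁻¹ • x) := by
  rw [Real.fourierInv_eq', waveIntegral]
  congr 1
  ext ξ
  have h : 2 * Real.pi * ((2 * Real.pi)⁻¹ * ⟪ξ, x⟫) = ⟪ξ, x⟫ := by
    rw [← mul_assoc, mul_inv_cancel₀ (by positivity), one_mul]
  rw [inner_smul_right, h, smul_eq_mul, mul_comm, mul_comm Complex.I]

theorem exists_schwartz_eq_waveIntegral (g : SchwartzMap E ℂ) :
    ∃ h : SchwartzMap E ℂ, ⇑h = waveIntegral g := by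
  have hc : (2 * Real.pi)⁻¹ ≠ 0 := by positivity
  refine ⟨SchwartzMap.compCLMOfContinuousLinearEquiv ℂ (dilation E hc)
    (FourierTransformInv.fourierInv g), ?_⟩
  ext x
  rw [waveIntegral_eq_fourierInv, SchwartzMap.compCLMOfContinuousLinearEquiv_apply,
    SchwartzMap.fourierInv_coe]
  rfl

theorem exists_waveIntegral_eq_schwartz (h : SchwartzMap E ℂ) :
    ∃ g : SchwartzMap E ℂ, ⇑h = waveIntegral g := by
  have hc : 2 * Real.pi ≠ 0 := by positivity
  set f := SchwartzMap.compCLMOfContinuousLinearEquiv ℂ (dilation E hc) h with hf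
  refine ⟨FourierTransform.fourier f, ?_⟩
  ext x
  rw [waveIntegral_eq_fourierInv, ← SchwartzMap.fourierInv_coe,
    FourierTransform.fourierInv_fourier_eq, hf, SchwartzMap.compCLMOfContinuousLinearEquiv_apply,
    Function.comp_apply, dilation_apply, smul_smul, mul_inv_cancel₀ hc, one_smul]

theorem SchwartzMap.integrable_norm_mul_one_add_sq (g : SchwartzMap E ℂ) :
    Integrable fun ξ => ‖g ξ‖ * (1 + ‖ξ‖ ^ 2) := by
  refine ((g.integrable_pow_mul volume 0).add (g.integrable_pow_mul volume 2)).congr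
    (ae_of_all _ fun ξ => ?_)
  simp only [Pi.add_apply]
  ring

theorem le_one_add_sq (a : ℝ) : a ≤ 1 + a ^ 2 := by nlinarith [sq_nonneg (a - 1)]

theorem SchwartzMap.integrable_mul_wave (g : SchwartzMap E ℂ) (x : E) :
    Integrable fun ξ => g ξ * Complex.exp (Complex.I * ((⟪ξ, x⟫ : ℝ) : ℂ)) := by
  refine g.integrable.norm.mono' ?_ (ae_of_all _ fun ξ => (norm_mul_wave _ _).le)
  exact (g.continuous.mul (by fun_prop)).aestronglyMeasurable

theorem hasDerivAt_waveIntegral_line (g : SchwartzMap E ℂ) (x v : E) :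
    Integrable (fun ξ => g ξ * Complex.exp (Complex.I * ((⟪ξ, x⟫ : ℝ) : ℂ))
      * (Complex.I * ((⟪ξ, v⟫ : ℝ) : ℂ))) ∧
    HasDerivAt (fun r : ℝ => waveIntegral g (x + r • v))
      (∫ ξ, g ξ * Complex.exp (Complex.I * ((⟪ξ, x⟫ : ℝ) : ℂ)) *
        (Complex.I * ((⟪ξ, v⟫ : ℝ) : ℂ))) 0 := by
  have hd : ∀ (ξ : E) (r : ℝ), HasDerivAt
      (fun r : ℝ => g ξ * Complex.exp (Complex.I * ((⟪ξ, x + r • v⟫ : ℝ) : ℂ)))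
      (g ξ * Complex.exp (Complex.I * ((⟪ξ, x + r • v⟫ : ℝ) : ℂ)) *
        (Complex.I * ((⟪ξ, v⟫ : ℝ) : ℂ))) r := by
    intro ξ r
    have h1 : HasDerivAt (fun r : ℝ => ⟪ξ, x⟫ + r * ⟪ξ, v⟫) ⟪ξ, v⟫ r := by
      simpa using ((hasDerivAt_id r).mul_const ⟪ξ, v⟫).const_add ⟪ξ, x⟫
    simp only [inner_add_right, inner_smul_right]
    have h2 := ((h1.ofReal_comp.const_mul Complex.I).cexp).const_mul (g ξ)
    simpa only [mul_assoc] using h2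
  have hb : ∀ (ξ : E) (r : ℝ), ‖g ξ * Complex.exp (Complex.I * ((⟪ξ, x + r • v⟫ : ℝ) : ℂ)) *
        (Complex.I * ((⟪ξ, v⟫ : ℝ) : ℂ))‖ ≤ (‖g ξ‖ * (1 + ‖ξ‖ ^ 2)) * ‖v‖ := by
    intro ξ r
    rw [norm_mul, norm_mul_wave, norm_mul, Complex.norm_I, one_mul, Complex.norm_real, mul_assoc]
    gcongr
    refine (abs_real_inner_le_norm _ _).trans ?_
    gcongr
    exact le_one_add_sq _
  have key := hasDerivAt_integral_of_dominated_loc_of_deriv_le (μ := (volume : Measure E))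
    (F := fun (r : ℝ) ξ => g ξ * Complex.exp (Complex.I * ((⟪ξ, x + r • v⟫ : ℝ) : ℂ)))
    (x₀ := 0) (s := univ) univ_mem
    (Eventually.of_forall fun r => (g.integrable_mul_wave _).aestronglyMeasurable)
    (g.integrable_mul_wave _)
    (F' := fun (r : ℝ) ξ => g ξ * Complex.exp (Complex.I * ((⟪ξ, x + r • v⟫ : ℝ) : ℂ)) *
        (Complex.I * ((⟪ξ, v⟫ : ℝ) : ℂ)))
    ((g.continuous.mul (by fun_prop)).mul (by fun_prop)).aestronglyMeasurable
    (ae_of_all _ fun ξ r _ => hb ξ r) (g.integrable_norm_mul_one_add_sq.mul_const _)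
    (ae_of_all _ fun ξ r _ => hd ξ r)
  simp only [zero_smul, add_zero] at key
  exact key

theorem fderiv_eq_integral_wave {g h : SchwartzMap E ℂ} (hg : ⇑h = waveIntegral g) (x v : E) :
    fderiv ℝ h x v = ∫ ξ, g ξ * Complex.exp (Complex.I * ((⟪ξ, x⟫ : ℝ) : ℂ)) *
        (Complex.I * ((⟪ξ, v⟫ : ℝ) : ℂ)) := by
  have h1 := (hasDerivAt_waveIntegral_line g x v).2
  rw [← hg] at h1
  exact (h.differentiableAt.hasFDerivAt.hasLineDerivAt v).unique h1

/-- The compensated increment of a function at `x` under a jump `u`. -/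
def jumpIncrement {F : Type*} [NormedAddCommGroup F] [NormedSpace ℝ F]
    (h : E → F) (x u : E) : F :=
  h (x + u) - h x - if ‖u‖ ≤ 1 then fderiv ℝ h x u else 0

theorem jumpIncrement_eq_integral {g h : SchwartzMap E ℂ} (hg : ⇑h = waveIntegral g) (x u : E) :
    jumpIncrement h x u
      = ∫ ξ, g ξ * Complex.exp (Complex.I * ((⟪ξ, x⟫ : ℝ) : ℂ)) * levyKernel ξ u := by
  have e1 : ∀ ξ : E, Complex.exp (Complex.I * ((⟪ξ, x + u⟫ : ℝ) : ℂ))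
      = Complex.exp (Complex.I * ((⟪ξ, x⟫ : ℝ) : ℂ)) * Complex.exp (Complex.I * ((⟪ξ, u⟫ : ℝ) : ℂ))
      := by
    intro ξ
    rw [← Complex.exp_add, inner_add_right, Complex.ofReal_add, mul_add]
  have h1 : h (x + u) - h x = ∫ ξ, (g ξ * Complex.exp (Complex.I * ((⟪ξ, x + u⟫ : ℝ) : ℂ))
      - g ξ * Complex.exp (Complex.I * ((⟪ξ, x⟫ : ℝ) : ℂ))) := by
    rw [hg, integral_sub (g.integrable_mul_wave _) (g.integrable_mul_wave _)]
    rfl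
  have h1i : Integrable fun ξ => g ξ * Complex.exp (Complex.I * ((⟪ξ, x + u⟫ : ℝ) : ℂ))
      - g ξ * Complex.exp (Complex.I * ((⟪ξ, x⟫ : ℝ) : ℂ)) :=
    (g.integrable_mul_wave (x + u)).sub (g.integrable_mul_wave x)
  unfold jumpIncrement
  by_cases hu : ‖u‖ ≤ 1
  · rw [if_pos hu, h1, fderiv_eq_integral_wave hg, ← integral_sub h1i
      (hasDerivAt_waveIntegral_line g x u).1]
    refine integral_congr_ae (ae_of_all _ fun ξ => ?_)
    simp only [levyKernel, hu, if_true, e1]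
    ring
  · rw [if_neg hu, sub_zero, h1]
    refine integral_congr_ae (ae_of_all _ fun ξ => ?_)
    simp only [levyKernel, hu, if_false, e1]
    ring

theorem integrable_wave_mul_levyKernel (g : SchwartzMap E ℂ) {m : Measure E} [SFinite m]
    (hm : Integrable (fun u => min 1 (‖u‖ ^ 2)) m) (x : E) :
    Integrable (fun p : E × E => g p.1 * Complex.exp (Complex.I * ((⟪p.1, x⟫ : ℝ) : ℂ))
      * levyKernel p.1 p.2) (volume.prod m) := by
  refine ((g.integrable_norm_mul_one_add_sq.const_mul 2).mul_prod hm).mono' ?_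
    (ae_of_all _ fun p => ?_)
  · have hgm : Measurable fun p : E × E => g p.1 := g.continuous.measurable.comp measurable_fst
    have := measurable_levyKernel (E := E)
    exact ((hgm.mul (by fun_prop)).mul this).aestronglyMeasurable
  · rw [norm_mul, norm_mul_wave]
    calc _ ≤ ‖g p.1‖ * (2 * (1 + ‖p.1‖ ^ 2) * min 1 (‖p.2‖ ^ 2)) := by
          gcongr; exact norm_levyKernel_le _ _
      _ = _ := by ring

theorem integrable_jumpIncrement (h : SchwartzMap E ℂ) {m : Measure E} [SFinite m]
    (hm : Integrable (fun u => min 1 (‖u‖ ^ 2)) m) (x : E) :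
    Integrable (jumpIncrement h x) m := by
  obtain ⟨g, hg⟩ := exists_waveIntegral_eq_schwartz h
  refine (integrable_wave_mul_levyKernel g hm x).integral_prod_right.congr
    (ae_of_all _ fun u => ?_)
  exact (jumpIncrement_eq_integral hg x u).symm

/-- The generator with drift `β`, no diffusion part and jump measure `m`. -/
def jumpGenerator {F : Type*} [NormedAddCommGroup F] [NormedSpace ℝ F]
    (β : E) (m : Measure E) (h : E → F) (x : E) : F :=
  fderiv ℝ h x β + ∫ u, jumpIncrement h x u ∂m

theorem jumpGenerator_eq_waveIntegral {g h : SchwartzMap E ℂ} (hg : ⇑h = waveIntegral g)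
    {m : Measure E} [SFinite m] (hm : Integrable (fun u => min 1 (‖u‖ ^ 2)) m) (β x : E) :
    jumpGenerator β m h x = waveIntegral (fun ξ => g ξ * levyExponent β m ξ) x := by
  have hi := integrable_wave_mul_levyKernel g hm x
  have h1 : ∫ u, jumpIncrement h x u ∂m
      = ∫ ξ, g ξ * Complex.exp (Complex.I * ((⟪ξ, x⟫ : ℝ) : ℂ)) * ∫ u, levyKernel ξ u ∂m := by
    simp_rw [jumpIncrement_eq_integral hg x]
    rw [← integral_integral_swap (f := fun ξ u => g ξ * Complex.exp (Complex.I * ((⟪ξ, x⟫ : ℝ) : ℂ))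
      * levyKernel ξ u) hi]
    simp_rw [integral_const_mul]
  have h2 : Integrable fun ξ => g ξ * Complex.exp (Complex.I * ((⟪ξ, x⟫ : ℝ) : ℂ))
      * ∫ u, levyKernel ξ u ∂m := by
    refine hi.integral_prod_left.congr (ae_of_all _ fun ξ => ?_)
    simp only [integral_const_mul]
  rw [jumpGenerator, h1, fderiv_eq_integral_wave hg, waveIntegral,
    ← integral_add (hasDerivAt_waveIntegral_line g x β).1 h2]
  refine integral_congr_ae (ae_of_all _ fun ξ => ?_)
  simp only [levyExponent, real_inner_comm]
  ring

theorem SchwartzMap.integrable_mul_levyExponent (g : SchwartzMap E ℂ) {m : Measure E}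
    (hm : Integrable (fun u => min 1 (‖u‖ ^ 2)) m) (β : E) :
    Integrable fun ξ => g ξ * levyExponent β m ξ := by
  refine (g.integrable_norm_mul_one_add_sq.const_mul (‖β‖ + 2 * ∫ u, min 1 (‖u‖ ^ 2) ∂m)).mono'
    (g.continuous.mul (continuous_levyExponent β hm)).aestronglyMeasurable (ae_of_all _ fun ξ => ?_)
  rw [norm_mul]
  calc _ ≤ ‖g ξ‖ * ((‖β‖ + 2 * ∫ u, min 1 (‖u‖ ^ 2) ∂m) * (1 + ‖ξ‖ ^ 2)) := by
        gcongr; exact norm_levyExponent_le β hm ξ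
    _ = _ := by ring

theorem integrable_prod_wave {G : E → ℂ} (hG : Integrable G) (μ : Measure E) [IsFiniteMeasure μ] :
    Integrable (fun p : E × E => G p.2 * Complex.exp (Complex.I * ((⟪p.2, p.1⟫ : ℝ) : ℂ)))
      (μ.prod volume) := by
  refine (hG.comp_snd μ).norm.mono' ?_ (ae_of_all _ fun p => (norm_mul_wave _ _).le)
  refine (hG.comp_snd μ).aestronglyMeasurable.mul ?_
  exact Continuous.aestronglyMeasurable (by fun_prop)

theorem integral_waveIntegral {G : E → ℂ} (hG : Integrable G) (μ : Measure E) [IsFiniteMeasure μ] :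
    Integrable (waveIntegral G) μ ∧ ∫ x, waveIntegral G x ∂μ
      = ∫ ξ, G ξ * ∫ x, Complex.exp (Complex.I * ((⟪ξ, x⟫ : ℝ) : ℂ)) ∂μ := by
  have hi := integrable_prod_wave hG μ
  refine ⟨hi.integral_prod_left, ?_⟩
  unfold waveIntegral
  rw [integral_integral_swap
    (f := fun x ξ => G ξ * Complex.exp (Complex.I * ((⟪ξ, x⟫ : ℝ) : ℂ))) hi]
  simp_rw [integral_const_mul]

omit [InnerProductSpace ℝ E] [FiniteDimensional ℝ E] [BorelSpace E] [MeasurableSpace E] in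
theorem one_add_sq_exp_smul_le [NormedSpace ℝ E] {s T : ℝ} (hs : s ≤ T) (ξ : E) :
    1 + ‖Real.exp s • ξ‖ ^ 2 ≤ (1 + Real.exp T ^ 2) * (1 + ‖ξ‖ ^ 2) := by
  rw [norm_smul, Real.norm_of_nonneg (Real.exp_pos s).le, mul_pow]
  have h1 : Real.exp s ^ 2 ≤ Real.exp T ^ 2 := by gcongr
  nlinarith [sq_nonneg ‖ξ‖, sq_nonneg (Real.exp T)]

theorem SchwartzMap.integrable_mul_of_norm_le (g : SchwartzMap E ℂ) {w : E → ℂ} {C : ℝ}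
    (hw : Continuous w) (hC : ∀ ξ, ‖w ξ‖ ≤ C * (1 + ‖ξ‖ ^ 2)) :
    Integrable fun ξ => g ξ * w ξ := by
  refine (g.integrable_norm_mul_one_add_sq.const_mul C).mono'
    (g.continuous.mul hw).aestronglyMeasurable (ae_of_all _ fun ξ => ?_)
  rw [norm_mul]
  calc _ ≤ ‖g ξ‖ * (C * (1 + ‖ξ‖ ^ 2)) := by gcongr; exact hC ξ
    _ = _ := by ring

/-- A radial differential equation implies its integrated form against Schwartz functions. -/
theorem hasDerivAt_integral_of_radial {φ w : E → ℂ} {C : ℝ} (hφ : Continuous φ)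
    (hφ1 : ∀ ξ, ‖φ ξ‖ ≤ 1) (hw : Continuous w) (hC0 : 0 ≤ C)
    (hC : ∀ ξ, ‖w ξ‖ ≤ C * (1 + ‖ξ‖ ^ 2))
    (hd : ∀ ξ (s : ℝ), HasDerivAt (fun s : ℝ => φ (Real.exp s • ξ)) (w (Real.exp s • ξ)) s)
    (g : SchwartzMap E ℂ) :
    HasDerivAt (fun s : ℝ => ∫ ξ, g ξ * φ (Real.exp s • ξ)) (∫ ξ, g ξ * w ξ) 0 := by
  have hφi : ∀ s : ℝ, Integrable fun ξ => g ξ * φ (Real.exp s • ξ) := fun s =>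
    g.integrable_mul_of_norm_le (C := 1) (hφ.comp (by fun_prop)) fun ξ =>
      (hφ1 _).trans (by nlinarith [sq_nonneg ‖ξ‖])
  have key := hasDerivAt_integral_of_dominated_loc_of_deriv_le (μ := (volume : Measure E))
    (F := fun (s : ℝ) ξ => g ξ * φ (Real.exp s • ξ)) (x₀ := 0) (s := Iio 1) (Iio_mem_nhds one_pos)
    (Eventually.of_forall fun s => (hφi s).aestronglyMeasurable) (hφi 0)
    (F' := fun (s : ℝ) ξ => g ξ * w (Real.exp s • ξ))
    (bound := fun ξ => (C * (1 + Real.exp 1 ^ 2)) * (‖g ξ‖ * (1 + ‖ξ‖ ^ 2)))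
    ((g.continuous.mul (hw.comp (by fun_prop))).aestronglyMeasurable)
    (ae_of_all _ fun ξ s hs => ?_) (g.integrable_norm_mul_one_add_sq.const_mul _)
    (ae_of_all _ fun ξ s _ => (hd ξ s).const_mul (g ξ))
  · simpa only [Real.exp_zero, one_smul] using key.2
  · rw [norm_mul]
    calc _ ≤ ‖g ξ‖ * (C * ((1 + Real.exp 1 ^ 2) * (1 + ‖ξ‖ ^ 2))) := by
          gcongr
          refine (hC _).trans ?_
          gcongr
          exact one_add_sq_exp_smul_le (le_of_lt hs) ξ
      _ = _ := by ring

theorem hasDerivAt_integral_of_forall_zero {φ w : E → ℂ}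
    (hd : ∀ g : SchwartzMap E ℂ,
      HasDerivAt (fun s : ℝ => ∫ ξ, g ξ * φ (Real.exp s • ξ)) (∫ ξ, g ξ * w ξ) 0)
    (g : SchwartzMap E ℂ) (t : ℝ) :
    HasDerivAt (fun s : ℝ => ∫ ξ, g ξ * φ (Real.exp s • ξ))
      (∫ ξ, g ξ * w (Real.exp t • ξ)) t := by
  have hc : Real.exp (-t) ≠ 0 := (Real.exp_pos _).ne'
  set G := SchwartzMap.compCLMOfContinuousLinearEquiv ℂ (dilation E hc) g with hG
  have hsc : ∀ f : E → ℂ, ∫ ξ, g ξ * f (Real.exp t • ξ)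
      = |((Real.exp t) ^ Module.finrank ℝ E)⁻¹| • ∫ ξ, G ξ * f ξ := by
    intro f
    rw [← Measure.integral_comp_smul volume (fun ξ => G ξ * f ξ) (Real.exp t)]
    refine integral_congr_ae (ae_of_all _ fun ξ => ?_)
    have : G (Real.exp t • ξ) = g ξ := by
      rw [hG, SchwartzMap.compCLMOfContinuousLinearEquiv_apply, Function.comp_apply,
        dilation_apply, smul_smul, ← Real.exp_add]
      simp
    simp only [this]
  have h1 := (hd G).const_smul |((Real.exp t) ^ Module.finrank ℝ E)⁻¹|
  rw [← hsc] at h1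
  have h2 : HasDerivAt (fun s : ℝ => s - t) 1 t := (hasDerivAt_id t).sub_const t
  have h3 := HasDerivAt.scomp t (by rwa [sub_self]) h2 (h := fun s : ℝ => s - t)
  rw [one_smul] at h3
  refine h3.congr_of_eventuallyEq (Eventually.of_forall fun s => ?_)
  simp only [Function.comp_apply, Pi.smul_apply]
  rw [← hsc fun ξ => φ (Real.exp (s - t) • ξ)]
  refine integral_congr_ae (ae_of_all _ fun ξ => ?_)
  simp only [smul_smul, ← Real.exp_add, sub_add_cancel]

/-- The integrated form of a radial differential equation implies the pointwise one. -/
theorem radial_of_hasDerivAt_integral {φ w : E → ℂ} {C : ℝ} (hφ : Continuous φ)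
    (hφ1 : ∀ ξ, ‖φ ξ‖ ≤ 1) (hw : Continuous w) (hC0 : 0 ≤ C)
    (hC : ∀ ξ, ‖w ξ‖ ≤ C * (1 + ‖ξ‖ ^ 2))
    (hd : ∀ g : SchwartzMap E ℂ,
      HasDerivAt (fun s : ℝ => ∫ ξ, g ξ * φ (Real.exp s • ξ)) (∫ ξ, g ξ * w ξ) 0)
    (ξ : E) (s : ℝ) :
    HasDerivAt (fun s : ℝ => φ (Real.exp s • ξ)) (w (Real.exp s • ξ)) s := by
  have hwc : Continuous (Function.uncurry fun (ξ : E) (t : ℝ) => w (Real.exp t • ξ)) :=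
    hw.comp (by fun_prop)
  have hwc' : ∀ ξ : E, Continuous fun t : ℝ => w (Real.exp t • ξ) := fun ξ =>
    hw.comp (by fun_prop)
  have hφi : ∀ (g : SchwartzMap E ℂ) (s : ℝ), Integrable fun ξ => g ξ * φ (Real.exp s • ξ) :=
    fun g s => g.integrable_mul_of_norm_le (C := 1) (hφ.comp (by fun_prop)) fun ξ =>
      (hφ1 _).trans (by nlinarith [sq_nonneg ‖ξ‖])
  have hprod : ∀ (g : SchwartzMap E ℂ) (b : ℝ),
      Integrable (Function.uncurry fun (t : ℝ) (ξ : E) => g ξ * w (Real.exp t • ξ))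
        ((volume.restrict (uIoc 0 b)).prod volume) := by
    intro g b
    have hone : Integrable (fun _ : ℝ => C * (1 + Real.exp (max 0 b) ^ 2))
        (volume.restrict (uIoc 0 b)) := integrableOn_const (by simp [uIoc])
    have hmem : ∀ᵐ p : ℝ × E ∂((volume.restrict (uIoc 0 b)).prod volume), p.1 ∈ uIoc 0 b :=
      Measure.quasiMeasurePreserving_fst.ae (ae_restrict_mem measurableSet_uIoc)
    refine (hone.mul_prod g.integrable_norm_mul_one_add_sq).mono' ?_ ?_
    · have : Continuous (Function.uncurry fun (t : ℝ) (ξ : E) => g ξ * w (Real.exp t • ξ)) :=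
        (g.continuous.comp continuous_snd).mul (hw.comp (by fun_prop))
      exact this.aestronglyMeasurable
    · filter_upwards [hmem] with p hp
      rw [Function.uncurry, norm_mul]
      calc _ ≤ ‖g p.2‖ * (C * ((1 + Real.exp (max 0 b) ^ 2) * (1 + ‖p.2‖ ^ 2))) := by
            gcongr
            refine (hC _).trans ?_
            gcongr
            exact one_add_sq_exp_smul_le hp.2 _
        _ = _ := by ring
  have hDc : ∀ b : ℝ, Continuous fun ξ : E =>
      φ (Real.exp b • ξ) - φ ξ - ∫ t in (0 : ℝ)..b, w (Real.exp t • ξ) := fun b =>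
    ((hφ.comp (by fun_prop)).sub hφ).sub
      (intervalIntegral.continuous_parametric_intervalIntegral_of_continuous' hwc 0 b)
  have hDint : ∀ (g : SchwartzMap E ℂ) (b : ℝ), ∫ ξ, g ξ *
      (φ (Real.exp b • ξ) - φ ξ - ∫ t in (0 : ℝ)..b, w (Real.exp t • ξ)) = 0 := by
    intro g b
    have h1 : ∫ t in (0 : ℝ)..b, ∫ ξ, g ξ * w (Real.exp t • ξ)
        = (∫ ξ, g ξ * φ (Real.exp b • ξ)) - ∫ ξ, g ξ * φ (Real.exp 0 • ξ) := by
      refine intervalIntegral.integral_eq_sub_of_hasDerivAt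
        (fun t _ => hasDerivAt_integral_of_forall_zero hd g t) ?_
      rw [intervalIntegrable_iff]
      exact (hprod g b).integral_prod_left
    rw [intervalIntegral_integral_swap (hprod g b)] at h1
    have h2 : Integrable fun ξ => ∫ t in (0 : ℝ)..b, g ξ * w (Real.exp t • ξ) := by
      simp only [intervalIntegral.intervalIntegral_eq_integral_uIoc]
      exact (hprod g b).integral_prod_right.smul _
    have h3 : ∀ ξ, g ξ * (φ (Real.exp b • ξ) - φ ξ - ∫ t in (0 : ℝ)..b, w (Real.exp t • ξ))
        = (g ξ * φ (Real.exp b • ξ) - g ξ * φ (Real.exp 0 • ξ))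
          - ∫ t in (0 : ℝ)..b, g ξ * w (Real.exp t • ξ) := by
      intro ξ
      rw [intervalIntegral.integral_const_mul, Real.exp_zero, one_smul]
      ring
    simp_rw [h3]
    have h4 : Integrable fun ξ => g ξ * φ (Real.exp b • ξ) - g ξ * φ (Real.exp 0 • ξ) :=
      (hφi g b).sub (hφi g 0)
    rw [integral_sub h4 h2, h1, integral_sub (hφi g b) (hφi g 0), sub_self]
  have hD : ∀ (b : ℝ) (ξ : E),
      φ (Real.exp b • ξ) - φ ξ - ∫ t in (0 : ℝ)..b, w (Real.exp t • ξ) = 0 := by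
    intro b
    have h0 := ae_eq_zero_of_integral_contDiff_smul_eq_zero (μ := (volume : Measure E))
      (hDc b).locallyIntegrable fun g hg hgc => by
        have h1 := hDint ((hgc.comp_left (g := Complex.ofReal) Complex.ofReal_zero).toSchwartzMap
          (Complex.ofRealCLM.contDiff.comp hg)) b
        simp only [Complex.real_smul]
        exact h1
    exact congr_fun ((Continuous.ae_eq_iff_eq volume (hDc b) continuous_const).1 h0)
  have h4 : HasDerivAt (fun b => φ ξ + ∫ t in (0 : ℝ)..b, w (Real.exp t • ξ))
      (w (Real.exp s • ξ)) s :=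
    ((hwc' ξ).integral_hasStrictDerivAt 0 s).hasDerivAt.const_add _
  refine h4.congr_of_eventuallyEq (Eventually.of_forall fun b => ?_)
  have := hD b ξ
  simp only
  linear_combination this

omit [FiniteDimensional ℝ E] [BorelSpace E] in
theorem charFun_eq_integral_wave (μ : Measure E) (ξ : E) :
    charFun μ ξ = ∫ x, Complex.exp (Complex.I * ((⟪ξ, x⟫ : ℝ) : ℂ)) ∂μ := by
  rw [charFun_apply]
  refine integral_congr_ae (ae_of_all _ fun x => ?_)
  simp only [real_inner_comm, mul_comm]

omit [FiniteDimensional ℝ E] [MeasurableSpace E] [BorelSpace E] in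
theorem SchwartzMap.exists_norm_fderiv_le {F : Type*} [NormedAddCommGroup F] [NormedSpace ℝ F]
    (h : SchwartzMap E F) (n : ℕ) : ∃ C, ∀ x, ‖x‖ ^ n * ‖fderiv ℝ h x‖ ≤ C := by
  obtain ⟨C, -, hC⟩ := h.decay n 1
  exact ⟨C, fun x => by simpa only [norm_iteratedFDeriv_one] using hC x⟩

omit [FiniteDimensional ℝ E] [MeasurableSpace E] [BorelSpace E] in
theorem SchwartzMap.continuous_fderiv {F : Type*} [NormedAddCommGroup F] [NormedSpace ℝ F]
    (h : SchwartzMap E F) : Continuous (fderiv ℝ h) :=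
  (h.smooth 1).continuous_fderiv (by simp)

omit [FiniteDimensional ℝ E] in
theorem SchwartzMap.integrable_fderiv_self {F : Type*} [NormedAddCommGroup F] [NormedSpace ℝ F]
    [SecondCountableTopology F] (h : SchwartzMap E F) (μ : Measure E) [IsFiniteMeasure μ] :
    Integrable (fun x => fderiv ℝ h x x) μ := by
  obtain ⟨C, hC⟩ := h.exists_norm_fderiv_le 1
  refine (integrable_const C).mono'
    (h.continuous_fderiv.clm_apply continuous_id).aestronglyMeasurable (ae_of_all _ fun x => ?_)
  refine (ContinuousLinearMap.le_opNorm _ _).trans ((le_of_eq ?_).trans (hC x))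
  ring

omit [FiniteDimensional ℝ E] in
theorem SchwartzMap.integrable_fderiv_apply {F : Type*} [NormedAddCommGroup F] [NormedSpace ℝ F]
    [SecondCountableTopology F] (h : SchwartzMap E F) (μ : Measure E) [IsFiniteMeasure μ] (v : E) :
    Integrable (fun x => fderiv ℝ h x v) μ := by
  obtain ⟨C, hC⟩ := h.exists_norm_fderiv_le 0
  refine (integrable_const (C * ‖v‖)).mono'
    (h.continuous_fderiv.clm_apply continuous_const).aestronglyMeasurable (ae_of_all _ fun x => ?_)
  refine (ContinuousLinearMap.le_opNorm _ _).trans ?_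
  gcongr
  simpa using hC x

omit [FiniteDimensional ℝ E] in
theorem hasDerivAt_integral_exp_smul (h : SchwartzMap E ℂ) (μ : Measure E) [IsFiniteMeasure μ] :
    HasDerivAt (fun s : ℝ => ∫ x, h (Real.exp s • x) ∂μ) (∫ x, fderiv ℝ h x x ∂μ) 0 := by
  obtain ⟨C, hC⟩ := h.exists_norm_fderiv_le 1
  have hcont : ∀ s : ℝ, Continuous fun x => h (Real.exp s • x) := fun s =>
    h.continuous.comp (by fun_prop)
  have hd : ∀ (x : E) (s : ℝ), HasDerivAt (fun s : ℝ => h (Real.exp s • x))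
      (fderiv ℝ h (Real.exp s • x) (Real.exp s • x)) s := fun x s =>
    h.differentiableAt.hasFDerivAt.comp_hasDerivAt s ((Real.hasDerivAt_exp s).smul_const x)
  have hInt : Integrable (fun x => h (Real.exp 0 • x)) μ := by
    obtain ⟨D, -, hD⟩ := h.decay 0 0
    refine (integrable_const D).mono' (hcont 0).aestronglyMeasurable (ae_of_all _ fun x => ?_)
    simpa using hD (Real.exp 0 • x)
  have key := hasDerivAt_integral_of_dominated_loc_of_deriv_le (μ := μ)
    (F := fun (s : ℝ) x => h (Real.exp s • x)) (x₀ := 0) (s := univ) univ_mem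
    (Eventually.of_forall fun s => (hcont s).aestronglyMeasurable) hInt
    (F' := fun (s : ℝ) x => fderiv ℝ h (Real.exp s • x) (Real.exp s • x))
    (bound := fun _ => C)
    ((h.continuous_fderiv.comp (by fun_prop)).clm_apply (by fun_prop)).aestronglyMeasurable
    (ae_of_all _ fun x s _ => ?_) (integrable_const C) (ae_of_all _ fun x s _ => hd x s)
  · simpa only [Real.exp_zero, one_smul] using key.2
  · refine (ContinuousLinearMap.le_opNorm _ _).trans ((le_of_eq ?_).trans (hC (Real.exp s • x)))
    ring

theorem integral_smul_eq_integral_mul_charFun {g h : SchwartzMap E ℂ} (hg : ⇑h = waveIntegral g)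
    (μ : Measure E) [IsFiniteMeasure μ] (c : ℝ) :
    ∫ x, h (c • x) ∂μ = ∫ ξ, g ξ * charFun μ (c • ξ) := by
  have hm : Measurable fun x : E => c • x := by fun_prop
  have : IsFiniteMeasure (μ.map fun x => c • x) := inferInstance
  rw [← integral_map (f := ⇑h) hm.aemeasurable h.continuous.aestronglyMeasurable, hg,
    (integral_waveIntegral g.integrable _).2]
  simp_rw [← charFun_eq_integral_wave, charFun_map_smul]

theorem jumpGenerator_integral {g h : SchwartzMap E ℂ} (hg : ⇑h = waveIntegral g)
    {m : Measure E} [SFinite m] (hm : Integrable (fun u => min 1 (‖u‖ ^ 2)) m) (β : E)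
    (μ : Measure E) [IsFiniteMeasure μ] :
    Integrable (jumpGenerator β m h) μ ∧
    ∫ x, jumpGenerator β m h x ∂μ = ∫ ξ, g ξ * (levyExponent β m ξ * charFun μ ξ) := by
  have h1 := integral_waveIntegral (g.integrable_mul_levyExponent hm β) μ
  rw [← funext (jumpGenerator_eq_waveIntegral hg hm β)] at h1
  refine ⟨h1.1, h1.2.trans ?_⟩
  simp_rw [← charFun_eq_integral_wave, mul_assoc]

/-- The Stein identity against complex Schwartz functions is equivalent to a radial differential
equation for the characteristic function. -/
theorem forall_integral_eq_iff_radial {m : Measure E} [SFinite m]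
    (hm : Integrable (fun u => min 1 (‖u‖ ^ 2)) m) (β : E) (μ : Measure E)
    [IsProbabilityMeasure μ] :
    (∀ h : SchwartzMap E ℂ, ∫ x, fderiv ℝ h x x ∂μ = ∫ x, jumpGenerator β m h x ∂μ) ↔
    ∀ (ξ : E) (s : ℝ), HasDerivAt (fun s : ℝ => charFun μ (Real.exp s • ξ))
      (levyExponent β m (Real.exp s • ξ) * charFun μ (Real.exp s • ξ)) s := by
  have hφ : Continuous (charFun μ) := continuous_charFun
  have hw : Continuous fun ξ => levyExponent β m ξ * charFun μ ξ :=
    (continuous_levyExponent β hm).mul hφ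
  have hC0 : 0 ≤ ‖β‖ + 2 * ∫ u, min 1 (‖u‖ ^ 2) ∂m := by
    have : 0 ≤ ∫ u, min 1 (‖u‖ ^ 2) ∂m := integral_nonneg fun u => by positivity
    positivity
  have hC : ∀ ξ, ‖levyExponent β m ξ * charFun μ ξ‖
      ≤ (‖β‖ + 2 * ∫ u, min 1 (‖u‖ ^ 2) ∂m) * (1 + ‖ξ‖ ^ 2) := fun ξ => by
    rw [norm_mul]
    exact (mul_le_of_le_one_right (norm_nonneg _) (norm_charFun_le_one ξ)).trans
      (norm_levyExponent_le β hm ξ)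
  have hder : ∀ {g h : SchwartzMap E ℂ}, ⇑h = waveIntegral g →
      HasDerivAt (fun s : ℝ => ∫ ξ, g ξ * charFun μ (Real.exp s • ξ))
        (∫ x, fderiv ℝ h x x ∂μ) 0 := fun {g h} hg => by
    simpa only [integral_smul_eq_integral_mul_charFun hg] using hasDerivAt_integral_exp_smul h μ
  constructor
  · intro H
    refine radial_of_hasDerivAt_integral hφ norm_charFun_le_one hw hC0 hC fun g => ?_
    obtain ⟨h, hg⟩ := exists_schwartz_eq_waveIntegral g
    rw [← (jumpGenerator_integral hg hm β μ).2, ← H h]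
    exact hder hg
  · intro H h
    obtain ⟨g, hg⟩ := exists_waveIntegral_eq_schwartz h
    rw [(jumpGenerator_integral hg hm β μ).2]
    exact (hder hg).unique
      (hasDerivAt_integral_of_radial hφ norm_charFun_le_one hw hC0 hC H g)

omit [FiniteDimensional ℝ E] [BorelSpace E] in
theorem levyExponent_zero (b : E) (m : Measure E) : levyExponent b m 0 = 0 := by
  simp [levyExponent, levyKernel]

omit [FiniteDimensional ℝ E] [MeasurableSpace E] [BorelSpace E] in
/-- The radial differential equation characterizes the exponential of a primitive of its
coefficient. -/
theorem radial_iff_eq_exp {φ ψ q : E → ℂ} (hφ : Continuous φ) (hφ0 : φ 0 = 1)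
    (hψ : Continuous ψ) (hψ0 : ψ 0 = 0)
    (hd : ∀ (ξ : E) (s : ℝ),
      HasDerivAt (fun s : ℝ => ψ (Real.exp s • ξ)) (q (Real.exp s • ξ)) s) :
    (∀ (ξ : E) (s : ℝ), HasDerivAt (fun s : ℝ => φ (Real.exp s • ξ))
      (q (Real.exp s • ξ) * φ (Real.exp s • ξ)) s) ↔ ∀ ξ, φ ξ = Complex.exp (ψ ξ) := by
  constructor
  · intro H ξ
    have h1 : ∀ s : ℝ, HasDerivAt
        (fun s : ℝ => φ (Real.exp s • ξ) * Complex.exp (-ψ (Real.exp s • ξ))) 0 s := fun s => by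
      have := (H ξ s).mul (hd ξ s).neg.cexp
      refine this.congr_deriv ?_
      simp only [Pi.neg_apply]
      ring
    have h2 := is_const_of_deriv_eq_zero (fun s => (h1 s).differentiableAt) fun s => (h1 s).deriv
    have h3 : Tendsto (fun s : ℝ => φ (Real.exp s • ξ) * Complex.exp (-ψ (Real.exp s • ξ)))
        atBot (𝓝 1) := by
      have hc : Continuous fun t : ℝ => φ (t • ξ) * Complex.exp (-ψ (t • ξ)) :=
        (hφ.comp (by fun_prop)).mul (Complex.continuous_exp.comp (hψ.comp (by fun_prop)).neg)
      have h4 := (hc.tendsto 0).comp Real.tendsto_exp_atBot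
      simp only [zero_smul, hφ0, hψ0, neg_zero, Complex.exp_zero, mul_one] at h4
      exact h4
    have h5 : Tendsto (fun s : ℝ => φ (Real.exp s • ξ) * Complex.exp (-ψ (Real.exp s • ξ)))
        atBot (𝓝 (φ (Real.exp 0 • ξ) * Complex.exp (-ψ (Real.exp 0 • ξ)))) :=
      tendsto_const_nhds.congr fun s => h2 0 s
    have h6 := tendsto_nhds_unique h5 h3
    rw [Real.exp_zero, one_smul, Complex.exp_neg] at h6
    exact eq_of_mul_inv_eq_one h6
  · intro H ξ s
    simp only [H]
    exact (hd ξ s).cexp.congr_deriv (mul_comm _ _)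

section comp

variable {F G : Type*} [NormedAddCommGroup F] [NormedSpace ℝ F] [NormedAddCommGroup G]
  [NormedSpace ℝ G]

omit [FiniteDimensional ℝ E] [MeasurableSpace E] [BorelSpace E] in
theorem SchwartzMap.fderiv_postcompCLM (L : F →L[ℝ] G) (h : SchwartzMap E F) (x v : E) :
    fderiv ℝ (h.postcompCLM L) x v = L (fderiv ℝ h x v) := by
  have h1 : HasFDerivAt (h.postcompCLM L) (L ∘L fderiv ℝ h x) x :=
    L.hasFDerivAt.comp x h.differentiableAt.hasFDerivAt
  rw [h1.fderiv]
  rfl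

omit [FiniteDimensional ℝ E] [MeasurableSpace E] [BorelSpace E] in
theorem jumpIncrement_postcompCLM (L : F →L[ℝ] G) (h : SchwartzMap E F) (x u : E) :
    jumpIncrement (h.postcompCLM L) x u = L (jumpIncrement h x u) := by
  simp only [jumpIncrement, SchwartzMap.fderiv_postcompCLM, SchwartzMap.postcompCLM_apply, map_sub,
    apply_ite L, map_zero]

omit [FiniteDimensional ℝ E] [BorelSpace E] in
theorem jumpGenerator_postcompCLM [CompleteSpace F] [CompleteSpace G] (L : F →L[ℝ] G)
    (h : SchwartzMap E F) (β : E) {m : Measure E} {x : E}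
    (hi : Integrable (jumpIncrement h x) m) :
    jumpGenerator β m (h.postcompCLM L) x = L (jumpGenerator β m h x) := by
  simp only [jumpGenerator, SchwartzMap.fderiv_postcompCLM, jumpIncrement_postcompCLM, map_add,
    L.integral_comp_comm hi]

end comp

omit [FiniteDimensional ℝ E] [MeasurableSpace E] [BorelSpace E] in
theorem SchwartzMap.postcompCLM_re_ofReal (f : SchwartzMap E ℝ) :
    (f.postcompCLM Complex.ofRealCLM).postcompCLM Complex.reCLM = f := by
  ext x; simp

theorem integrable_jumpGenerator (h : SchwartzMap E ℂ) {m : Measure E} [SFinite m]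
    (hm : Integrable (fun u => min 1 (‖u‖ ^ 2)) m) (β : E) (μ : Measure E) [IsFiniteMeasure μ] :
    Integrable (jumpGenerator β m h) μ := by
  obtain ⟨g, hg⟩ := exists_waveIntegral_eq_schwartz h
  exact (jumpGenerator_integral hg hm β μ).1

theorem integrable_jumpGenerator_real (f : SchwartzMap E ℝ) {m : Measure E} [SFinite m]
    (hm : Integrable (fun u => min 1 (‖u‖ ^ 2)) m) (β : E) (μ : Measure E) [IsFiniteMeasure μ] :
    Integrable (jumpGenerator β m f) μ := by
  have h := Complex.reCLM.integrable_comp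
    (integrable_jumpGenerator (f.postcompCLM Complex.ofRealCLM) hm β μ)
  simp only [← jumpGenerator_postcompCLM Complex.reCLM _ β (integrable_jumpIncrement _ hm _)] at h
  rwa [SchwartzMap.postcompCLM_re_ofReal] at h

theorem forall_integral_eq_real_iff_complex {m : Measure E} [SFinite m]
    (hm : Integrable (fun u => min 1 (‖u‖ ^ 2)) m) (β : E) (μ : Measure E) [IsFiniteMeasure μ] :
    (∀ f : SchwartzMap E ℝ, ∫ x, fderiv ℝ f x x ∂μ = ∫ x, jumpGenerator β m f x ∂μ) ↔
    ∀ h : SchwartzMap E ℂ, ∫ x, fderiv ℝ h x x ∂μ = ∫ x, jumpGenerator β m h x ∂μ := by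
  have hL1 : ∀ (L : ℂ →L[ℝ] ℝ) (h : SchwartzMap E ℂ),
      ∫ x, fderiv ℝ (h.postcompCLM L) x x ∂μ = L (∫ x, fderiv ℝ h x x ∂μ) := fun L h => by
    simp only [SchwartzMap.fderiv_postcompCLM]
    exact L.integral_comp_comm (h.integrable_fderiv_self μ)
  have hL2 : ∀ (L : ℂ →L[ℝ] ℝ) (h : SchwartzMap E ℂ),
      ∫ x, jumpGenerator β m (h.postcompCLM L) x ∂μ = L (∫ x, jumpGenerator β m h x ∂μ) :=
    fun L h => by
      simp only [jumpGenerator_postcompCLM L h β (integrable_jumpIncrement h hm _)]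
      exact L.integral_comp_comm (integrable_jumpGenerator h hm β μ)
  constructor
  · intro H h
    have h1 := H (h.postcompCLM Complex.reCLM)
    have h2 := H (h.postcompCLM Complex.imCLM)
    rw [hL1, hL2] at h1 h2
    exact Complex.ext h1 h2
  · intro H f
    have := congrArg Complex.reCLM (H (f.postcompCLM Complex.ofRealCLM))
    rwa [← hL1, ← hL2, SchwartzMap.postcompCLM_re_ofReal] at this

omit [MeasurableSpace E] [BorelSpace E] in
theorem SchwartzMap.inner_gradient (f : SchwartzMap E ℝ) (x v : E) :
    ⟪gradient f x, v⟫ = fderiv ℝ f x v := by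
  simp [gradient]

theorem SchwartzMap.integrable_gradient (f : SchwartzMap E ℝ) (μ : Measure E)
    [IsFiniteMeasure μ] : Integrable (gradient f) μ := by
  obtain ⟨C, hC⟩ := f.exists_norm_fderiv_le 0
  refine (integrable_const C).mono'
    (((InnerProductSpace.toDual ℝ E).symm.continuous).comp
      f.continuous_fderiv).aestronglyMeasurable (ae_of_all _ fun x => ?_)
  simpa [gradient] using hC x

theorem stein_rhs_eq_integral_jumpGenerator (f : SchwartzMap E ℝ) (μ σ : Measure E)
    [IsFiniteMeasure μ] {m : Measure E} [SFinite m]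
    (hm : Integrable (fun u => min 1 (‖u‖ ^ 2)) m) (b : E) {κ : E → ℝ}
    (hκ : Integrable (fun y => κ y • y) σ) :
    ⟪b, ∫ x, gradient f x ∂μ⟫ - ∫ x, (∫ y, κ y * ⟪gradient f x, y⟫ ∂σ) ∂μ
      + ∫ x, ∫ u, (f (x + u) - f x - (if ‖u‖ ≤ 1 then ⟪gradient f x, u⟫ else 0)) ∂m ∂μ
      = ∫ x, jumpGenerator (b - ∫ y, κ y • y ∂σ) m f x ∂μ := by
  set V := ∫ y, κ y • y ∂σ with hV
  have h1 : ⟪b, ∫ x, gradient f x ∂μ⟫ = ∫ x, fderiv ℝ f x b ∂μ := by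
    rw [← integral_inner (f.integrable_gradient μ)]
    simp only [real_inner_comm, ← f.inner_gradient]
  have h2 : ∀ x, ∫ y, κ y * ⟪gradient f x, y⟫ ∂σ = fderiv ℝ f x V := fun x => by
    rw [hV, ← ContinuousLinearMap.integral_comp_comm _ hκ]
    simp only [map_smul, smul_eq_mul, f.inner_gradient]
  have hb := f.integrable_fderiv_apply μ b
  have hVi := f.integrable_fderiv_apply μ V
  have hG := integrable_jumpGenerator_real f hm (b - V) μ
  have h3 : ∀ x, ∫ u, (f (x + u) - f x - (if ‖u‖ ≤ 1 then ⟪gradient f x, u⟫ else 0)) ∂m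
      = jumpGenerator (b - V) m f x - (fderiv ℝ f x b - fderiv ℝ f x V) := fun x => by
    simp only [jumpGenerator, jumpIncrement, f.inner_gradient, map_sub]
    ring
  have hbV : Integrable (fun x => fderiv ℝ f x b - fderiv ℝ f x V) μ := hb.sub hVi
  simp only [h1, h2, h3]
  rw [integral_sub hG hbV, integral_sub hb hVi]
  ring

theorem stein_identity_iff_charFun {ν m : Measure E} [SFinite m]
    (hν : Integrable (fun u => min 1 (‖u‖ ^ 2)) ν)
    (hm : Integrable (fun u => min 1 (‖u‖ ^ 2)) m)
    (hνm : ν = (m.prod logMeasure).map fun p => p.2 • p.1) {b β : E}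
    (hβ : b = β + ∫ u in {u | 1 < ‖u‖}, ‖u‖⁻¹ • u ∂m) (μ : Measure E) [IsProbabilityMeasure μ] :
    (∀ f : SchwartzMap E ℝ, ∫ x, fderiv ℝ f x x ∂μ = ∫ x, jumpGenerator β m f x ∂μ) ↔
    ∀ ξ, charFun μ ξ = Complex.exp (levyExponent b ν ξ) := by
  rw [forall_integral_eq_real_iff_complex hm β μ, forall_integral_eq_iff_radial hm β μ]
  refine radial_iff_eq_exp continuous_charFun (by simp) (continuous_levyExponent b hν)
    (levyExponent_zero b ν) fun ξ s => ?_
  have h1 := (hasDerivAt_levyExponent_smul hν hm hνm hβ ξ (Real.exp_pos s)).scomp s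
    (Real.hasDerivAt_exp s)
  refine h1.congr_deriv ?_
  rw [Complex.real_smul, ← mul_assoc, ← Complex.ofReal_mul,
    mul_one_div_cancel (Real.exp_pos s).ne', Complex.ofReal_one, one_mul]

theorem measure_zero_singleton_of_radial {νt σ : Measure E} {τ : E → Measure ℝ}
    (hσ : σ {x | ¬ ‖x‖ = 1} = 0) (hτ : ∀ x, τ x (Iic 0) = 0)
    (hνt : ∀ g : E → ℝ≥0∞, Measurable g →
      ∫⁻ u, g u ∂νt = ∫⁻ x, (∫⁻ r, g (r • x) ∂(τ x)) ∂σ) : νt {0} = 0 := by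
  have hg : Measurable (({0} : Set E).indicator (1 : E → ℝ≥0∞)) :=
    measurable_one.indicator (measurableSet_singleton 0)
  rw [← lintegral_indicator_one (measurableSet_singleton (0 : E)), hνt _ hg,
    ← lintegral_zero (μ := σ)]
  refine lintegral_congr_ae ?_
  filter_upwards [ae_norm_eq_one hσ] with x hx
  have hx0 : x ≠ 0 := by rintro rfl; simp at hx
  rw [← lintegral_zero (μ := τ x)]
  refine lintegral_congr_ae ?_
  have hpos : ∀ᵐ r ∂(τ x), 0 < r := by
    rw [ae_iff]; simp only [not_lt]; exact hτ x
  filter_upwards [hpos] with r hr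
  refine indicator_of_notMem ?_ _
  simp [hr.ne', hx0]

end

/-- Characterization of self-decomposable laws (Cauchy-type boundary behaviour
`lim_{ε→0⁺} ε k_x(ε) = k_x(1)`) via a Stein-type identity (`thm:caracSD2`).
Here `ν` has polar decomposition `k_x(r)/r dr σ(dx)` (hypothesis `hpolar`),
`τ x` is the Lebesgue–Stieltjes measure of the nonincreasing function `k x`
(hypothesis `hτ`) and `νt` is the measure `ν̃(du) = (−dk_x(r)) σ(dx)` (hypothesis `hνt`). -/
theorem stmt4 {d : ℕ}
    (μ ν νt : Measure (EuclideanSpace ℝ (Fin d))) [IsProbabilityMeasure μ]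
    (σ : Measure (EuclideanSpace ℝ (Fin d))) [IsFiniteMeasure σ]
    (τ : EuclideanSpace ℝ (Fin d) → Measure ℝ)
    (b : EuclideanSpace ℝ (Fin d))
    (k : EuclideanSpace ℝ (Fin d) → ℝ → ℝ)
    (hσ : σ {x : EuclideanSpace ℝ (Fin d) | ¬ ‖x‖ = 1} = 0)
    (hLevy : IsLevyMeasure ν)
    (hk0 : ∀ x, ∀ r : ℝ, 0 < r → 0 ≤ k x r)
    (hkcr : ∀ x, ContinuousOn (k x) (Ioi 0))
    (hkmono : ∀ x, AntitoneOn (k x) (Ioi 0))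
    (hkcx : ∀ r : ℝ, 0 < r →
      ContinuousOn (fun x => k x r) {x : EuclideanSpace ℝ (Fin d) | ‖x‖ = 1})
    (hklim0 : ∀ x, ‖x‖ = 1 → Tendsto (fun r => r * k x r) (𝓝[>] 0) (𝓝 (k x 1)))
    (hkliminfty : ∀ x, ‖x‖ = 1 → Tendsto (k x) atTop (𝓝 0))
    (hkint : ∫⁻ r in Ioi (0 : ℝ),
        ENNReal.ofReal (min 1 (r ^ 2) *
          (⨆ x ∈ {x : EuclideanSpace ℝ (Fin d) | ‖x‖ = 1}, k x r) / r) < ⊤)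
    (hpolar : ∀ g : EuclideanSpace ℝ (Fin d) → ℝ≥0∞, Measurable g →
      ∫⁻ u, g u ∂ν
        = ∫⁻ x, (∫⁻ r in Ioi (0 : ℝ), g (r • x) * ENNReal.ofReal (k x r / r)) ∂σ)
    (hvar : ∀ (xs : ℕ → EuclideanSpace ℝ (Fin d)) (x : EuclideanSpace ℝ (Fin d)),
      (∀ n, ‖xs n‖ = 1) → ‖x‖ = 1 → Tendsto xs atTop (𝓝 x) →
      ∀ a : ℝ, 0 < a →
        Tendsto (fun n => eVariationOn (fun r => k (xs n) r - k x r) (Ici a)) atTop (𝓝 0))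
    (hτ : ∀ x : EuclideanSpace ℝ (Fin d),
      (∀ a c : ℝ, 0 < a → a ≤ c → τ x (Ioc a c) = ENNReal.ofReal (k x a - k x c))
        ∧ τ x (Iic 0) = 0)
    (hνt : ∀ g : EuclideanSpace ℝ (Fin d) → ℝ≥0∞, Measurable g →
      ∫⁻ u, g u ∂νt = ∫⁻ x, (∫⁻ r, g (r • x) ∂(τ x)) ∂σ)
    (hνtint : ∫⁻ u, ENNReal.ofReal (min 1 (‖u‖ ^ 2)) ∂νt < ⊤) :
    (∀ f : SchwartzMap (EuclideanSpace ℝ (Fin d)) ℝ,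
        ∫ x, ⟪x, gradient (⇑f) x⟫ ∂μ
          = ⟪b, ∫ x, gradient (⇑f) x ∂μ⟫
            - ∫ x, (∫ y, k y 1 * ⟪gradient (⇑f) x, y⟫ ∂σ) ∂μ
            + ∫ x, ∫ u, (f (x + u) - f x
                - (if ‖u‖ ≤ 1 then ⟪gradient (⇑f) x, u⟫ else 0)) ∂νt ∂μ)
      ↔ (∀ ξ, charFn μ ξ
          = Complex.exp (Complex.I * ((⟪b, ξ⟫ : ℝ) : ℂ)
              + ∫ u, (Complex.exp (Complex.I * ((⟪ξ, u⟫ : ℝ) : ℂ)) - 1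
                  - (if ‖u‖ ≤ 1 then Complex.I * ((⟪ξ, u⟫ : ℝ) : ℂ) else 0)) ∂ν)) := by
  have : SigmaFinite νt := sigmaFinite_of_lintegral_min_lt_top
    (measure_zero_singleton_of_radial hσ (fun x => (hτ x).2) hνt) hνtint
  have hm := integrable_min_one_sq hνtint
  have hν := integrable_min_one_sq hLevy.2
  have hνm := levy_eq_map hσ hkliminfty hpolar hτ hνt
  have hκ := integrable_drift hσ (hkcx 1 one_pos)
  have hV := drift_eq_integral hσ (fun x => hk0 x 1 one_pos) (hkcx 1 one_pos) hkliminfty hτ hνt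
  have hβ : b = (b - ∫ y, k y 1 • y ∂σ) + ∫ u in {u | 1 < ‖u‖}, ‖u‖⁻¹ • u ∂νt := by
    rw [← hV, sub_add_cancel]
  have key := stein_identity_iff_charFun hν hm hνm hβ μ
  simp only [charFun_eq_integral_wave] at key
  refine Iff.trans (forall_congr' fun f => ?_) key
  rw [stein_rhs_eq_integral_jumpGenerator f μ σ hm b hκ]
  simp only [← f.inner_gradient, real_inner_comm]
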